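/- arXiv:2003.04189 — 2 statements merged into one kernel-verified Lean document; each statement's English description precedes it below -/
import Mathlib

section
/- Let A ≅ kQ_A/I_A be a representation-finite monomial algebra whose Auslander-Reiten quiver is a component with length. If a and b are vertices of Q_A, neither of which is involved in any zero-relation of I_A, and there is an arrow from a to b in Q_A, then r_a = r_b. -/
open CategoryTheory
open scoped Classical

/-! ## Quiver combinatorics -/

/-- Paths in a quiver given by source and target maps. -/
inductive QPath {V E : Type} (src tgt : E → V) : V → V → Type
  | nil (a : V) : QPath src tgt a a
  | cons {a b : V} (p : QPath src tgt a b) (α : E) (h : src α = b) : QPath src tgt a (tgt α)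

namespace QPath

variable {V E : Type} {src tgt : E → V}

def length : ∀ {a b : V}, QPath src tgt a b → ℕ
  | _, _, .nil _ => 0
  | _, _, .cons p _ _ => p.length + 1

def comp : ∀ {a b c : V}, QPath src tgt a b → QPath src tgt b c → QPath src tgt a c
  | _, _, _, p, .nil _ => p
  | _, _, _, p, .cons q α h => .cons (p.comp q) α h

/-- The list of vertices visited by a path, in order. -/
def verts : ∀ {a b : V}, QPath src tgt a b → List V
  | a, _, .nil _ => [a]
  | _, _, .cons p α _ => p.verts ++ [tgt α]

/-- The interior (intermediate) vertices of a path. -/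
def interior {a b : V} (p : QPath src tgt a b) : List V :=
  (p.verts.dropLast).drop 1

/-- The list of arrows of a path, in walk order. -/
def arrows : ∀ {a b : V}, QPath src tgt a b → List E
  | _, _, .nil _ => []
  | _, _, .cons p α _ => p.arrows ++ [α]

end QPath

/-- A presentation of the algebra `A` by the (ordinary) quiver with vertex set `V`
and arrow set `E` : a complete family of orthogonal primitive idempotents indexed by
the vertices together with generators indexed by the arrows. -/
structure QuiverPresentation (k A V E : Type) [Field k] [Ring A] [Algebra k A]
    [Fintype V] [Fintype E] where
  src : E → V
  tgt : E → V
  idem : V → A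
  arrow : E → A
  idem_idem : ∀ a : V, idem a * idem a = idem a
  idem_orth : ∀ a b : V, a ≠ b → idem a * idem b = 0
  sum_idem : ∑ a : V, idem a = 1
  idem_ne : ∀ a : V, idem a ≠ 0
  idem_primitive : ∀ (v : V) (f g : A), f * f = f → g * g = g → f * g = 0 → g * f = 0 →
    f + g = idem v → f = 0 ∨ g = 0
  arrow_mem : ∀ α : E, idem (tgt α) * arrow α * idem (src α) = arrow α
  arrow_ne : ∀ α : E, arrow α ≠ 0
  generates : Algebra.adjoin k (Set.range idem ∪ Set.range arrow) = ⊤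

namespace QuiverPresentation

variable {k A V E : Type} [Field k] [Ring A] [Algebra k A] [Fintype V] [Fintype E]

/-- The product in `A` of the arrows along a path (paths are written right to left). -/
def qprod (P : QuiverPresentation k A V E) :
    ∀ {a b : V}, QPath P.src P.tgt a b → A
  | _, _, .nil a => P.idem a
  | _, _, .cons p α _ => P.arrow α * P.qprod p

/-- The ideal of relations is admissible: all sufficiently long paths vanish. -/
def Admissible (P : QuiverPresentation k A V E) : Prop :=
  ∃ N : ℕ, ∀ (a b : V) (p : QPath P.src P.tgt a b), N ≤ p.length → P.qprod p = 0

/-- The presentation is minimal: the idempotents and the arrows are linearly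
independent modulo the span of the products of paths of length at least two,
so that `(V, E)` really is the ordinary quiver of `A`. -/
def Minimal (P : QuiverPresentation k A V E) : Prop :=
  ∀ (c : V → k) (d : E → k),
    ((∑ a : V, c a • P.idem a) + ∑ α : E, d α • P.arrow α) ∈
      Submodule.span k {x : A | ∃ (a b : V) (p : QPath P.src P.tgt a b),
        2 ≤ p.length ∧ P.qprod p = x} →
    (∀ a, c a = 0) ∧ (∀ α, d α = 0)

/-- The algebra is monomial: the ideal of relations is generated by paths; equivalently,
the images of the paths which do not vanish are linearly independent. -/
def Monomial (P : QuiverPresentation k A V E) : Prop :=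
  LinearIndependent k
    (fun q : {q : Σ a : V, Σ b : V, QPath P.src P.tgt a b // P.qprod q.2.2 ≠ 0} =>
      P.qprod q.1.2.2)

/-- A (minimal) zero-relation: a path of length at least two whose product vanishes
while the product along every proper subpath does not. -/
def IsZeroRel (P : QuiverPresentation k A V E) {a b : V} (p : QPath P.src P.tgt a b) : Prop :=
  P.qprod p = 0 ∧ 2 ≤ p.length ∧
  ∀ (x y : V) (q : QPath P.src P.tgt x y) (p₁ : QPath P.src P.tgt a x)
    (p₂ : QPath P.src P.tgt y b),
      p = p₁.comp (q.comp p₂) → q.length < p.length → P.qprod q ≠ 0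

/-- A vertex `u` is involved in a zero-relation `α_m ⋯ α_1` if `u = s(α_i)`
for some `i = 2, …, m`, i.e. `u` is an interior vertex of the relation. -/
def InvolvedInZeroRel (P : QuiverPresentation k A V E) (u : V) : Prop :=
  ∃ (a b : V) (p : QPath P.src P.tgt a b), P.IsZeroRel p ∧ u ∈ p.interior

/-! ### Walks (for strings and for connectivity) -/

/-- The starting vertex of a step (an arrow traversed forwards or backwards). -/
def stepSrc (P : QuiverPresentation k A V E) (s : E × Bool) : V :=
  if s.2 then P.src s.1 else P.tgt s.1

/-- The ending vertex of a step. -/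
def stepTgt (P : QuiverPresentation k A V E) (s : E × Bool) : V :=
  if s.2 then P.tgt s.1 else P.src s.1

/-- `l` is a walk from `a` to `b` in the underlying graph of the quiver. -/
def IsWalkFrom (P : QuiverPresentation k A V E) : V → List (E × Bool) → V → Prop
  | a, [], b => a = b
  | a, s :: l, b => P.stepSrc s = a ∧ P.IsWalkFrom (P.stepTgt s) l b

/-- The product in `A` of a list of arrows (listed in walk order). -/
def wprod (P : QuiverPresentation k A V E) (l : List E) : A :=
  ((l.map P.arrow).reverse).prod

/-- A reduced walk: no step is immediately followed by its inverse. -/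
def Reduced (l : List (E × Bool)) : Prop :=
  ¬ ∃ (l₁ : List (E × Bool)) (s : E × Bool) (l₂ : List (E × Bool)),
      l = l₁ ++ s :: (s.1, !s.2) :: l₂

/-- No direct subwalk of `l` nor the inverse of such lies in the ideal of relations. -/
def NoZeroSub (P : QuiverPresentation k A V E) (l : List (E × Bool)) : Prop :=
  ∀ (l₁ : List (E × Bool)) (r : List E) (l₂ : List (E × Bool)),
    (l = l₁ ++ (r.map (fun e => (e, true))) ++ l₂ → P.wprod r ≠ 0) ∧
    (l = l₁ ++ (r.map (fun e => (e, false))) ++ l₂ → P.wprod r.reverse ≠ 0)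

/-- A string from `a` to `b`. -/
def IsStringWalk (P : QuiverPresentation k A V E) (a : V) (l : List (E × Bool)) (b : V) : Prop :=
  P.IsWalkFrom a l b ∧ Reduced l ∧ P.NoZeroSub l

/-- `(Q_u^s)_0` : the strings starting at `u` that are trivial or start with an arrow. -/
def QSset (P : QuiverPresentation k A V E) (u : V) : Set (List (E × Bool)) :=
  {l | ∃ b : V, P.IsStringWalk u l b ∧ (l = [] ∨ ∃ (α : E) (l' : List (E × Bool)),
    l = (α, true) :: l')}

/-- `(Q_u^e)_0` : the strings ending at `u` that are trivial or end with an arrow. -/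
def QEset (P : QuiverPresentation k A V E) (u : V) : Set (List (E × Bool)) :=
  {l | ∃ a : V, P.IsStringWalk a l u ∧ (l = [] ∨ ∃ (α : E) (l' : List (E × Bool)),
    l = l' ++ [(α, true)])}

/-- `S_γ` : the strings starting with the arrow `γ`. -/
def Sarr (P : QuiverPresentation k A V E) (γ : E) : Set (List (E × Bool)) :=
  {l | ∃ b : V, P.IsStringWalk (P.src γ) l b ∧ ∃ l' : List (E × Bool), l = (γ, true) :: l'}

/-- `E_γ` : the strings ending with the arrow `γ`. -/
def Earr (P : QuiverPresentation k A V E) (γ : E) : Set (List (E × Bool)) :=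
  {l | ∃ a : V, P.IsStringWalk a l (P.tgt γ) ∧ ∃ l' : List (E × Bool), l = l' ++ [(γ, true)]}

/-- The defining conditions of a string algebra. -/
def IsStringAlgebra (P : QuiverPresentation k A V E) : Prop :=
  P.Monomial ∧
  (∀ v : V, Nat.card {α : E // P.src α = v} ≤ 2) ∧
  (∀ v : V, Nat.card {α : E // P.tgt α = v} ≤ 2) ∧
  (∀ γ : E, Nat.card {β : E // P.src β = P.tgt γ ∧ P.arrow β * P.arrow γ ≠ 0} ≤ 1) ∧
  (∀ β : E, Nat.card {γ : E // P.src β = P.tgt γ ∧ P.arrow β * P.arrow γ ≠ 0} ≤ 1)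

/-- Connectivity in the underlying graph, avoiding a given set of arrows. -/
def ConnAvoid (P : QuiverPresentation k A V E) (avoid : Set E) (a b : V) : Prop :=
  ∃ l : List (E × Bool), P.IsWalkFrom a l b ∧ ∀ s ∈ l, s.1 ∉ avoid

def Connected (P : QuiverPresentation k A V E) : Prop := ∀ a b : V, P.ConnAvoid ∅ a b

/-- The underlying graph of the quiver is a tree. -/
def IsTreeQuiver (P : QuiverPresentation k A V E) : Prop :=
  P.Connected ∧ Fintype.card E + 1 = Fintype.card V

/-- The underlying (undirected) graph of the quiver is given by the edge-endpoint
specification `ends` on `nV` vertices and `nE` edges. -/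
def GraphSpec (P : QuiverPresentation k A V E) (nV nE : ℕ) (ends : Fin nE → ℕ × ℕ) : Prop :=
  ∃ (v : Fin nV ≃ V) (ar : Fin nE ≃ E), ∀ i : Fin nE, ∃ a b : Fin nV,
    (a : ℕ) = (ends i).1 ∧ (b : ℕ) = (ends i).2 ∧
    ((P.src (ar i) = v a ∧ P.tgt (ar i) = v b) ∨ (P.src (ar i) = v b ∧ P.tgt (ar i) = v a))

/-- The directed quiver is given by the arrow specification `ends`. -/
def DirGraphSpec (P : QuiverPresentation k A V E) (nV nE : ℕ) (ends : Fin nE → ℕ × ℕ) : Prop :=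
  ∃ (v : Fin nV ≃ V) (ar : Fin nE ≃ E), ∀ i : Fin nE, ∃ a b : Fin nV,
    (a : ℕ) = (ends i).1 ∧ (b : ℕ) = (ends i).2 ∧
    P.src (ar i) = v a ∧ P.tgt (ar i) = v b

/-- The underlying graph of the full subquiver on vertices `S` and arrows `T`. -/
def SubGraphSpec (P : QuiverPresentation k A V E) (S : Set V) (T : Set E)
    (nV nE : ℕ) (ends : Fin nE → ℕ × ℕ) : Prop :=
  ∃ (v : Fin nV ≃ S) (ar : Fin nE ≃ T), ∀ i : Fin nE, ∃ a b : Fin nV,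
    (a : ℕ) = (ends i).1 ∧ (b : ℕ) = (ends i).2 ∧
    ((P.src (ar i) = v a ∧ P.tgt (ar i) = v b) ∨ (P.src (ar i) = v b ∧ P.tgt (ar i) = v a))

end QuiverPresentation

/-- Edge endpoints of the Dynkin graph `A_n`. -/
def typeAEnds (n : ℕ) : Fin (n - 1) → ℕ × ℕ := fun i => ((i : ℕ), (i : ℕ) + 1)

/-- Edge endpoints of the Dynkin graph `D_n`. -/
def typeDEnds (n : ℕ) : Fin (n - 1) → ℕ × ℕ := fun i =>
  if (i : ℕ) = 0 then (0, 2) else if (i : ℕ) = 1 then (1, 2) else ((i : ℕ), (i : ℕ) + 1)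

/-- Edge endpoints of the Dynkin graph `E_m` for `m = 6, 7, 8`. -/
def typeEEnds (m : ℕ) : Fin (m - 1) → ℕ × ℕ := fun i =>
  if (i : ℕ) = m - 2 then (2, m - 1) else ((i : ℕ), (i : ℕ) + 1)

/-! ## The module category, its radical and the nilpotency index -/

section ModuleSide

variable (A : Type) [Ring A]

/-- An indecomposable module: non-zero, with no non-trivial idempotent endomorphism. -/
def Indec (M : ModuleCat.{0} A) : Prop :=
  Nontrivial M ∧ ∀ f : M ⟶ M, f ≫ f = f → f = 0 ∨ f = 𝟙 M

/-- A finitely generated indecomposable module. -/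
def FinIndec (M : ModuleCat.{0} A) : Prop := Module.Finite A M ∧ Indec A M

/-- `A` is representation-finite: finitely many finitely generated indecomposables
up to isomorphism. -/
def RepFinite : Prop :=
  ∃ (n : ℕ) (T : Fin n → ModuleCat.{0} A),
    ∀ M : ModuleCat.{0} A, FinIndec A M → ∃ i, Nonempty (M ≅ T i)

/-- `A` is (left) hereditary. -/
def Hereditary : Prop := ∀ I : Submodule A A, Module.Projective A I

/-- An irreducible morphism: it does not split, and in any factorization one of
the factors splits. -/
def IrredMor {X Y : ModuleCat.{0} A} (f : X ⟶ Y) : Prop :=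
  (¬ ∃ g : Y ⟶ X, f ≫ g = 𝟙 X) ∧ (¬ ∃ g : Y ⟶ X, g ≫ f = 𝟙 Y) ∧
  ∀ (Z : ModuleCat.{0} A), Module.Finite A Z → ∀ (u : X ⟶ Z) (v : Z ⟶ Y), f = u ≫ v →
    (∃ r : Z ⟶ X, u ≫ r = 𝟙 X) ∨ (∃ s : Y ⟶ Z, s ≫ v = 𝟙 Y)

/-- The radical of `Hom(X, Y)`. -/
def radSet (X Y : ModuleCat.{0} A) : Set (X ⟶ Y) :=
  {f | ∀ M : ModuleCat.{0} A, FinIndec A M →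
    ∀ (h : M ⟶ X) (h' : Y ⟶ M), ¬ IsIso (h ≫ f ≫ h')}

/-- Compositions of `n` radical morphisms. -/
def radPowSet : ℕ → ∀ (X Y : ModuleCat.{0} A), Set (X ⟶ Y)
  | 0, _, _ => Set.univ
  | n + 1, X, Y => {f | ∃ (M : ModuleCat.{0} A) (g : X ⟶ M) (h : M ⟶ Y),
      Module.Finite A M ∧ g ∈ radSet A X M ∧ h ∈ radPowSet n M Y ∧ f = g ≫ h}

/-- The `n`-th power of the radical of `mod A` vanishes. -/
def RadVanishes (n : ℕ) : Prop :=
  ∀ X Y : ModuleCat.{0} A, Module.Finite A X → Module.Finite A Y →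
    ∀ f ∈ radPowSet A n X Y, f = 0

/-- `m` is the nilpotency index of the radical of `mod A`. -/
def NilpotencyIndex (m : ℕ) : Prop :=
  1 ≤ m ∧ RadVanishes A m ∧ ∀ l : ℕ, RadVanishes A l → m ≤ l

/-- A path of irreducible morphisms between (f.g.) indecomposable modules,
together with its composite morphism and its length. -/
inductive IrrPath : ∀ (M N : ModuleCat.{0} A), (M ⟶ N) → ℕ → Prop
  | nil (M : ModuleCat.{0} A) : FinIndec A M → IrrPath M M (𝟙 M) 0
  | cons {M X N : ModuleCat.{0} A} (f : M ⟶ X) (g : X ⟶ N) (n : ℕ) :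
      FinIndec A M → IrredMor A f → IrrPath X N g n → IrrPath M N (f ≫ g) (n + 1)

/-- The Auslander–Reiten quiver of `A` is a component with length : parallel paths
of irreducible morphisms have the same length. -/
def WithLength : Prop :=
  ∀ (M N : ModuleCat.{0} A) (n m : ℕ),
    (∃ f : M ⟶ N, IrrPath A M N f n) → (∃ g : M ⟶ N, IrrPath A M N g m) → n = m

/-- `N` is a successor of `M` (a path of non-zero morphisms between f.g.
indecomposables from `M` to `N`). -/
inductive Reach : ModuleCat.{0} A → ModuleCat.{0} A → Prop
  | refl (M : ModuleCat.{0} A) : FinIndec A M → Reach M M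
  | cons {M X N : ModuleCat.{0} A} : FinIndec A M → FinIndec A X →
      (∃ f : M ⟶ X, f ≠ 0) → Reach X N → Reach M N

/-- `N` is a direct summand of `M`. -/
def IsSummand (N M : ModuleCat.{0} A) : Prop :=
  ∃ (i : N ⟶ M) (p : M ⟶ N), i ≫ p = 𝟙 N

/-- The radical of a module (intersection of the maximal submodules). -/
def radOf (M : ModuleCat.{0} A) : Submodule A M := sInf {N | IsCoatom N}

/-- The socle of a module (sum of the simple submodules). -/
def socOf (M : ModuleCat.{0} A) : Submodule A M := sSup {N | IsAtom N}

/-- `0 → X → E → Y → 0` is an almost split (Auslander–Reiten) sequence. -/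
def IsAlmostSplit {X E Y : ModuleCat.{0} A} (f : X ⟶ E) (g : E ⟶ Y) : Prop :=
  FinIndec A X ∧ FinIndec A Y ∧ Module.Finite A E ∧
  Function.Injective f ∧ Function.Surjective g ∧
  (∀ x : X, g (f x) = 0) ∧ (∀ e : E, g e = 0 → ∃ x : X, f x = e) ∧
  (¬ ∃ s : Y ⟶ E, s ≫ g = 𝟙 Y) ∧
  (∀ (M : ModuleCat.{0} A) (h : X ⟶ M), (¬ ∃ r : M ⟶ X, h ≫ r = 𝟙 X) →
    ∃ t : E ⟶ M, f ≫ t = h) ∧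
  (∀ (M : ModuleCat.{0} A) (h : M ⟶ Y), (¬ ∃ s : Y ⟶ M, s ≫ h = 𝟙 Y) →
    ∃ t : M ⟶ E, t ≫ g = h)

/-- `X = τ Y` : there is an almost split sequence `0 → X → E → Y → 0`. -/
def IsTauOf (X Y : ModuleCat.{0} A) : Prop :=
  ∃ (E : ModuleCat.{0} A) (f : X ⟶ E) (g : E ⟶ Y), IsAlmostSplit A f g

/-- A sectional path of irreducible morphisms of length `n` from `M` to `N`. -/
def SectionalPath (M N : ModuleCat.{0} A) (n : ℕ) : Prop :=
  ∃ Y : Fin (n + 1) → ModuleCat.{0} A,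
    Y 0 = M ∧ Y (Fin.last n) = N ∧ (∀ i, FinIndec A (Y i)) ∧
    (∀ i : Fin n, ∃ f : Y i.castSucc ⟶ Y i.succ, IrredMor A f) ∧
    ∀ (i : ℕ) (h : i + 2 ≤ n),
      ¬ IsTauOf A (Y ⟨i, by omega⟩) (Y ⟨i + 2, by omega⟩)

end ModuleSide

/-! ## Modules attached to vertices -/

section Vertices

variable {k A V E : Type} [Field k] [Ring A] [Algebra k A] [Fintype V] [Fintype E]

/-- `S` is the simple module at the vertex `a`. -/
def IsSimpleAt (P : QuiverPresentation k A V E) (a : V) (S : ModuleCat.{0} A) : Prop :=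
  IsSimpleModule A S ∧ ∃ x : S, P.idem a • x ≠ 0

/-- `Pm` is the indecomposable projective at the vertex `a`. -/
def IsProjAt (P : QuiverPresentation k A V E) (a : V) (Pm : ModuleCat.{0} A) : Prop :=
  Module.Projective A Pm ∧ FinIndec A Pm ∧
  ∃ (S : ModuleCat.{0} A) (f : Pm ⟶ S), IsSimpleAt P a S ∧ Function.Surjective f

/-- `Im` is the indecomposable injective at the vertex `a`. -/
def IsInjAt (P : QuiverPresentation k A V E) (a : V) (Im : ModuleCat.{0} A) : Prop :=
  Module.Injective A Im ∧ FinIndec A Im ∧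
  ∃ (S : ModuleCat.{0} A) (f : S ⟶ Im), IsSimpleAt P a S ∧ Function.Injective f

/-- `RVal P a n` : `n` is the length of a non-zero path of irreducible morphisms
between indecomposable modules from `P_a` to `I_a` going through `S_a`. -/
def RVal (P : QuiverPresentation k A V E) (a : V) (n : ℕ) : Prop :=
  ∃ (Pm S Im : ModuleCat.{0} A) (f : Pm ⟶ S) (g : S ⟶ Im) (n₁ n₂ : ℕ),
    IsProjAt P a Pm ∧ IsSimpleAt P a S ∧ IsInjAt P a Im ∧
    IrrPath A Pm S f n₁ ∧ IrrPath A S Im g n₂ ∧ f ≫ g ≠ 0 ∧ n = n₁ + n₂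

end Vertices


namespace QPath

variable {V E : Type} {src tgt : E → V}

theorem nil_comp {a b : V} (p : QPath src tgt a b) : (nil a).comp p = p := by
  induction p with
  | nil => rw [comp]
  | cons p β h ih => rw [comp, ih]

theorem comp_assoc {a b c d : V} (p : QPath src tgt a b) (q : QPath src tgt b c)
    (r : QPath src tgt c d) : (p.comp q).comp r = p.comp (q.comp r) := by
  induction r with
  | nil => rw [comp, comp]
  | cons r β h ih => rw [comp, comp, comp, ih]

theorem arrows_comp {a b c : V} (p : QPath src tgt a b) (q : QPath src tgt b c) :
    (p.comp q).arrows = p.arrows ++ q.arrows := by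
  induction q with
  | nil => simp [comp, arrows]
  | cons q β h ih => simp [comp, arrows, ih]

theorem length_arrows {a b : V} (p : QPath src tgt a b) : p.arrows.length = p.length := by
  induction p with
  | nil => simp [length, arrows]
  | cons p β h ih => simp [length, arrows, ih]

theorem length_comp {a b c : V} (p : QPath src tgt a b) (q : QPath src tgt b c) :
    (p.comp q).length = p.length + q.length := by
  simp [← length_arrows, arrows_comp]

theorem verts_eq {a b : V} (p : QPath src tgt a b) : p.verts = a :: p.arrows.map tgt := by
  induction p with
  | nil => simp [verts, arrows]
  | cons p β h ih => simp [verts, arrows, ih]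

theorem tgt_eq_of_arrows_eq {a b : V} (p : QPath src tgt a b) {l : List E} {γ : E}
    (h : p.arrows = l ++ [γ]) : tgt γ = b := by
  cases p with
  | nil => simp [arrows] at h
  | cons p β _ =>
    rw [arrows] at h
    have := (List.append_inj' h rfl).2
    simp_all

theorem tgt_mem_interior {a b : V} (p : QPath src tgt a b) {l l' : List E} {γ : E}
    (h : p.arrows = (l ++ [γ]) ++ l') (hl' : l' ≠ []) : tgt γ ∈ p.interior := by
  have : p.interior = (p.arrows.map tgt).dropLast := by
    rw [interior, verts_eq, List.dropLast_cons_of_ne_nil (by simp [h])]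
    rfl
  rw [this, h, List.map_append, List.dropLast_append_of_ne_nil (by simpa using hl')]
  simp

end QPath

namespace QuiverPresentation

variable {k A V E : Type} [Field k] [Ring A] [Algebra k A] [Fintype V] [Fintype E]
variable (P : QuiverPresentation k A V E)

theorem idem_tgt_mul_arrow (β : E) : P.idem (P.tgt β) * P.arrow β = P.arrow β := by
  rw [← P.arrow_mem β, ← mul_assoc, ← mul_assoc, P.idem_idem]

theorem arrow_mul_idem_src (β : E) : P.arrow β * P.idem (P.src β) = P.arrow β := by
  rw [← P.arrow_mem β, mul_assoc, P.idem_idem]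

theorem idem_mul_qprod {a b : V} (p : QPath P.src P.tgt a b) :
    P.idem b * P.qprod p = P.qprod p := by
  cases p with
  | nil => rw [qprod, P.idem_idem]
  | cons p β h => rw [qprod, ← mul_assoc, P.idem_tgt_mul_arrow]

theorem qprod_mul_idem {a b : V} (p : QPath P.src P.tgt a b) :
    P.qprod p * P.idem a = P.qprod p := by
  induction p with
  | nil => rw [qprod, P.idem_idem]
  | cons p β h ih => rw [qprod, mul_assoc, ih]

theorem qprod_comp {a b c : V} (p : QPath P.src P.tgt a b) (q : QPath P.src P.tgt b c) :
    P.qprod (p.comp q) = P.qprod q * P.qprod p := by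
  induction q with
  | nil => rw [QPath.comp, qprod, P.idem_mul_qprod]
  | cons q β h ih => rw [QPath.comp, qprod, qprod, ih, mul_assoc]

theorem qprod_mul_qprod_of_ne {a b c d : V} (p : QPath P.src P.tgt a b)
    (q : QPath P.src P.tgt c d) (h : c ≠ b) : P.qprod q * P.qprod p = 0 := by
  rw [← P.idem_mul_qprod p, ← P.qprod_mul_idem q, mul_assoc, ← mul_assoc (P.idem c),
    P.idem_orth c b h, zero_mul, mul_zero]

theorem wprod_append (l l' : List E) : P.wprod (l ++ l') = P.wprod l' * P.wprod l := by
  simp [wprod]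

theorem qprod_eq_wprod_arrows {a b : V} (p : QPath P.src P.tgt a b) (hp : p.arrows ≠ []) :
    P.qprod p = P.wprod p.arrows := by
  induction p with
  | nil => simp [QPath.arrows] at hp
  | cons p β h ih =>
    by_cases hp' : p.arrows = []
    · cases p with
      | nil =>
        subst h
        rw [qprod, qprod, P.arrow_mul_idem_src]
        simp [QPath.arrows, wprod]
      | cons p γ h' => simp [QPath.arrows] at hp'
    · rw [QPath.arrows, wprod_append, qprod, ih hp']
      simp [wprod]

theorem qprod_eq_zero_of_arrows_eq {a b c d : V} {p : QPath P.src P.tgt a b}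
    {r : QPath P.src P.tgt c d} (hr : P.qprod r = 0) {l l' : List E}
    (h : p.arrows = l ++ r.arrows ++ l') : P.qprod p = 0 := by
  have hne : r.arrows ≠ [] := by
    cases r with
    | nil => exact absurd (by rwa [qprod] at hr) (P.idem_ne c)
    | cons r β h => simp [QPath.arrows]
  rw [P.qprod_eq_wprod_arrows p (by simp [h, hne]), h, wprod_append, wprod_append,
    ← P.qprod_eq_wprod_arrows r hne, hr, zero_mul, mul_zero]

theorem exists_isZeroRel_of_qprod_eq_zero {a b : V} (p : QPath P.src P.tgt a b)
    (hp : P.qprod p = 0) :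
    ∃ (c d : V) (r : QPath P.src P.tgt c d) (l l' : List E),
      P.IsZeroRel r ∧ p.arrows = l ++ r.arrows ++ l' := by
  let S : ℕ → Prop := fun n => ∃ (c d : V) (r : QPath P.src P.tgt c d)
    (p₁ : QPath P.src P.tgt a c) (p₂ : QPath P.src P.tgt d b),
      p = p₁.comp (r.comp p₂) ∧ P.qprod r = 0 ∧ r.length = n
  have hS : ∃ n, S n := ⟨_, a, b, p, .nil a, .nil b, by rw [QPath.nil_comp, QPath.comp], hp, rfl⟩
  obtain ⟨c, d, r, p₁, p₂, hpr, hr, hn⟩ := Nat.find_spec hS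
  refine ⟨c, d, r, p₁.arrows, p₂.arrows, ⟨hr, ?_, ?_⟩, ?_⟩
  · cases r with
    | nil => exact absurd (by rwa [qprod] at hr) (P.idem_ne c)
    | cons r β h =>
      cases r with
      | nil =>
        subst h
        rw [qprod, qprod, P.arrow_mul_idem_src] at hr
        exact absurd hr (P.arrow_ne β)
      | cons r γ h' => simp [QPath.length]
  · intro x y q q₁ q₂ hq hlt hq0
    refine Nat.find_min hS (m := q.length) (by omega)
      ⟨x, y, q, p₁.comp q₁, q₂.comp p₂, ?_, hq0, rfl⟩
    rw [hpr, hq]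
    simp only [QPath.comp_assoc]
  · rw [hpr, QPath.arrows_comp, QPath.arrows_comp, List.append_assoc]

theorem qprod_comp_ne_zero {a b c : V} (p : QPath P.src P.tgt a b) (q : QPath P.src P.tgt b c)
    (hb : ¬ P.InvolvedInZeroRel b) (hp : P.qprod p ≠ 0) (hq : P.qprod q ≠ 0) :
    P.qprod (p.comp q) ≠ 0 := by
  intro h0
  obtain ⟨x, y, r, l, l', hr, h⟩ := P.exists_isZeroRel_of_qprod_eq_zero _ h0
  rw [QPath.arrows_comp, List.append_assoc, List.append_eq_append_iff] at h
  obtain ⟨m, -, h⟩ | ⟨m, hpm, h⟩ := h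
  · exact hq (P.qprod_eq_zero_of_arrows_eq hr.1 (h.trans (List.append_assoc _ _ _).symm))
  rw [List.append_eq_append_iff] at h
  obtain ⟨m', h, -⟩ | ⟨m', hrm, hqm⟩ := h
  · exact hp (P.qprod_eq_zero_of_arrows_eq hr.1 (by rw [hpm, h, List.append_assoc]))
  obtain rfl | ⟨n, γ, rfl⟩ := List.eq_nil_or_concat' m
  · refine hq (P.qprod_eq_zero_of_arrows_eq hr.1 (l := []) (l' := l') ?_)
    simpa [hrm] using hqm
  by_cases hm' : m' = []
  · subst hm'
    refine hp (P.qprod_eq_zero_of_arrows_eq hr.1 (l := l) (l' := []) ?_)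
    simpa [hrm] using hpm
  have hγ : P.tgt γ = b := p.tgt_eq_of_arrows_eq (hpm.trans (List.append_assoc _ _ _).symm)
  exact hb ⟨x, y, r, hr, hγ ▸ r.tgt_mem_interior hrm hm'⟩

/-- The span of the products along the paths of length at least `n`. -/
def pathSpan (n : ℕ) : Submodule k A :=
  Submodule.span k {x | ∃ (a b : V) (p : QPath P.src P.tgt a b), n ≤ p.length ∧ P.qprod p = x}

variable {P}

theorem qprod_mem_pathSpan {a b : V} (p : QPath P.src P.tgt a b) {n : ℕ} (h : n ≤ p.length) :
    P.qprod p ∈ P.pathSpan n :=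
  Submodule.subset_span ⟨a, b, p, h, rfl⟩

theorem pathSpan_mul_mem {m n : ℕ} {x y : A} (hx : x ∈ P.pathSpan m) (hy : y ∈ P.pathSpan n) :
    x * y ∈ P.pathSpan (m + n) := by
  have : P.pathSpan m * P.pathSpan n ≤ P.pathSpan (m + n) := by
    rw [pathSpan, pathSpan, Submodule.span_mul_span, Submodule.span_le]
    rintro _ ⟨_, ⟨c, d, q, hq, rfl⟩, _, ⟨a, b, p, hp, rfl⟩, rfl⟩
    by_cases h : c = b
    · subst h
      show P.qprod q * P.qprod p ∈ P.pathSpan (m + n)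
      rw [← qprod_comp]
      exact qprod_mem_pathSpan _ (by rw [QPath.length_comp]; omega)
    · show P.qprod q * P.qprod p ∈ P.pathSpan (m + n)
      rw [P.qprod_mul_qprod_of_ne p q h]
      exact zero_mem _
  exact this (Submodule.mul_mem_mul hx hy)

theorem idem_mem_pathSpan (v : V) : P.idem v ∈ P.pathSpan 0 := by
  simpa [qprod] using qprod_mem_pathSpan (QPath.nil v : QPath P.src P.tgt v v) (Nat.zero_le _)

theorem arrow_mem_pathSpan (β : E) : P.arrow β ∈ P.pathSpan 1 := by
  have := qprod_mem_pathSpan (P := P) (QPath.cons (.nil (P.src β)) β rfl) (n := 1)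
    (by simp [QPath.length])
  rwa [qprod, qprod, P.arrow_mul_idem_src] at this

theorem pathSpan_anti {m n : ℕ} (h : m ≤ n) : P.pathSpan n ≤ P.pathSpan m :=
  Submodule.span_mono fun _ ⟨a, b, p, hp, hx⟩ => ⟨a, b, p, h.trans hp, hx⟩

variable (P) in
theorem pathSpan_zero : P.pathSpan 0 = ⊤ := by
  let T : Subalgebra k A := (P.pathSpan 0).toSubalgebra
    (P.sum_idem ▸ Submodule.sum_mem _ fun v _ => idem_mem_pathSpan v)
    fun x y hx hy => pathSpan_mul_mem (m := 0) (n := 0) hx hy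
  have hT : T = ⊤ := by
    rw [eq_top_iff, ← P.generates, Algebra.adjoin_le_iff]
    rintro _ (⟨v, rfl⟩ | ⟨β, rfl⟩)
    · exact idem_mem_pathSpan v
    · exact pathSpan_anti (Nat.zero_le 1) (arrow_mem_pathSpan β)
  exact eq_top_iff.2 fun x _ => show x ∈ T from hT ▸ Algebra.mem_top

theorem mem_pathSpan_zero (x : A) : x ∈ P.pathSpan 0 := by
  rw [pathSpan_zero]
  trivial

theorem mul_mem_pathSpan (x : A) {y : A} {n : ℕ} (hy : y ∈ P.pathSpan n) :
    x * y ∈ P.pathSpan n := by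
  simpa using pathSpan_mul_mem (mem_pathSpan_zero x) hy

theorem mem_pathSpan_mul {x : A} (y : A) {n : ℕ} (hx : x ∈ P.pathSpan n) :
    x * y ∈ P.pathSpan n := by
  simpa only [add_zero] using pathSpan_mul_mem hx (mem_pathSpan_zero y)

theorem pow_mem_pathSpan {x : A} (hx : x ∈ P.pathSpan 1) (n : ℕ) : x ^ n ∈ P.pathSpan n := by
  induction n with
  | zero => exact mem_pathSpan_zero _
  | succ n ih => exact pow_succ x n ▸ pathSpan_mul_mem ih hx

theorem Admissible.exists_pathSpan_eq_bot (hadm : P.Admissible) : ∃ n, P.pathSpan n = ⊥ := by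
  obtain ⟨N, hN⟩ := hadm
  refine ⟨N, Submodule.span_eq_bot.2 ?_⟩
  rintro _ ⟨a, b, p, hp, rfl⟩
  exact hN a b p hp

theorem Admissible.isNilpotent (hadm : P.Admissible) {x : A} (hx : x ∈ P.pathSpan 1) :
    IsNilpotent x := by
  obtain ⟨n, hn⟩ := hadm.exists_pathSpan_eq_bot
  exact ⟨n, by simpa [hn] using pow_mem_pathSpan hx n⟩

theorem Admissible.idem_notMem (hadm : P.Admissible) (v : V) : P.idem v ∉ P.pathSpan 1 := by
  intro h
  obtain ⟨n, hn⟩ := hadm.isNilpotent h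
  have h0 : P.idem v ^ (n + 1) = P.idem v :=
    IsIdempotentElem.pow_succ_eq n (P.idem_idem v)
  rw [pow_succ, hn, zero_mul] at h0
  exact P.idem_ne v h0.symm

/-- A non-zero submodule contains a non-zero element killed by the arrow ideal. -/
theorem Admissible.exists_mul_eq_zero (hadm : P.Admissible) {M : Type} [AddCommGroup M]
    [Module A M] {N : Submodule A M} (hN : N ≠ ⊥) :
    ∃ x ∈ N, x ≠ 0 ∧ ∀ y ∈ P.pathSpan 1, y • x = 0 := by
  obtain ⟨n, hn⟩ := hadm.exists_pathSpan_eq_bot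
  obtain ⟨x, hx, hx0⟩ := N.ne_bot_iff.1 hN
  by_contra! hc
  have key : ∀ m : ℕ, ∃ y ∈ P.pathSpan m, y • x ≠ 0 := by
    intro m
    induction m with
    | zero => exact ⟨1, mem_pathSpan_zero _, by simpa⟩
    | succ m ih =>
      obtain ⟨y, hy, hyx⟩ := ih
      obtain ⟨z, hz, hzy⟩ := hc (y • x) (N.smul_mem y hx) hyx
      exact ⟨z * y, add_comm 1 m ▸ pathSpan_mul_mem hz hy, by rwa [mul_smul]⟩
  obtain ⟨y, hy, hyx⟩ := key n
  rw [hn, Submodule.mem_bot] at hy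
  exact hyx (by rw [hy, zero_smul])

theorem exists_mul_idem_sub_mem (v : V) (x : A) :
    ∃ c : k, x * P.idem v - c • P.idem v ∈ P.pathSpan 1 := by
  induction mem_pathSpan_zero (P := P) x using Submodule.span_induction with
  | mem x h =>
    obtain ⟨a, b, p, -, rfl⟩ := h
    cases p with
    | nil =>
      rw [qprod]
      by_cases h : a = v
      · exact ⟨1, by rw [h, P.idem_idem, one_smul, sub_self]; exact zero_mem _⟩
      · exact ⟨0, by rw [P.idem_orth _ _ h, zero_smul, sub_self]; exact zero_mem _⟩
    | cons p β h =>
      refine ⟨0, ?_⟩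
      rw [zero_smul, sub_zero]
      exact mem_pathSpan_mul _ (qprod_mem_pathSpan _ (by simp [QPath.length]))
  | zero => exact ⟨0, by simp⟩
  | add x y _ _ hx hy =>
    obtain ⟨c, hc⟩ := hx
    obtain ⟨d, hd⟩ := hy
    refine ⟨c + d, ?_⟩
    rw [add_mul, add_smul, add_sub_add_comm]
    exact add_mem hc hd
  | smul t x _ hx =>
    obtain ⟨c, hc⟩ := hx
    refine ⟨t * c, ?_⟩
    rw [smul_mul_assoc, mul_smul, ← smul_sub]
    exact Submodule.smul_mem _ t hc

theorem exists_idem_mul_sub_mem (v : V) (x : A) :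
    ∃ c : k, P.idem v * x - c • P.idem v ∈ P.pathSpan 1 := by
  induction mem_pathSpan_zero (P := P) x using Submodule.span_induction with
  | mem x h =>
    obtain ⟨a, b, p, -, rfl⟩ := h
    cases p with
    | nil =>
      rw [qprod]
      by_cases h : v = a
      · exact ⟨1, by rw [h, P.idem_idem, one_smul, sub_self]; exact zero_mem _⟩
      · exact ⟨0, by rw [P.idem_orth _ _ h, zero_smul, sub_self]; exact zero_mem _⟩
    | cons p β h =>
      refine ⟨0, ?_⟩
      rw [zero_smul, sub_zero]
      exact mul_mem_pathSpan _ (qprod_mem_pathSpan _ (by simp [QPath.length]))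
  | zero => exact ⟨0, by simp⟩
  | add x y _ _ hx hy =>
    obtain ⟨c, hc⟩ := hx
    obtain ⟨d, hd⟩ := hy
    refine ⟨c + d, ?_⟩
    rw [mul_add, add_smul, add_sub_add_comm]
    exact add_mem hc hd
  | smul t x _ hx =>
    obtain ⟨c, hc⟩ := hx
    refine ⟨t * c, ?_⟩
    rw [mul_smul_comm, mul_smul, ← smul_sub]
    exact Submodule.smul_mem _ t hc

/-- In a monomial algebra a linear map can be prescribed on the paths, provided that it
vanishes on the zero paths. -/
theorem Monomial.exists_linearMap (hmono : P.Monomial)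
    (φ : ∀ {a b : V}, QPath P.src P.tgt a b → A)
    (hφ : ∀ {a b : V} (p : QPath P.src P.tgt a b), P.qprod p = 0 → φ p = 0) :
    ∃ L : A →ₗ[k] A, ∀ (a b : V) (p : QPath P.src P.tgt a b), L (P.qprod p) = φ p := by
  have hspan : ⊤ ≤ Submodule.span k (Set.range
      (fun q : {q : Σ a : V, Σ b : V, QPath P.src P.tgt a b // P.qprod q.2.2 ≠ 0} =>
        P.qprod q.1.2.2)) := by
    rw [← pathSpan_zero P, pathSpan, Submodule.span_le]
    rintro _ ⟨a, b, p, -, rfl⟩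
    by_cases hp : P.qprod p = 0
    · rw [hp]
      exact zero_mem _
    · exact Submodule.subset_span ⟨⟨⟨a, b, p⟩, hp⟩, rfl⟩
  let B := Module.Basis.mk hmono hspan
  refine ⟨B.constr k fun q => φ q.1.2.2, fun a b p => ?_⟩
  by_cases hp : P.qprod p = 0
  · rw [hp, map_zero, hφ p hp]
  · have : B ⟨⟨a, b, p⟩, hp⟩ = P.qprod p := Module.Basis.mk_apply hmono hspan _
    rw [← this, Module.Basis.constr_basis]

variable (P) in
/-- The product along a path from which the last arrow has been removed if it is `α`,
and zero if the last arrow is different from `α`. -/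
noncomputable def removeLast (α : E) : ∀ {a b : V}, QPath P.src P.tgt a b → A
  | _, _, .nil _ => 0
  | _, _, .cons p β _ => if β = α then P.qprod p else 0

variable (P) in
/-- The product along a path from which the first arrow has been removed if it is `α`,
and zero if the first arrow is different from `α`. -/
noncomputable def removeFirst (α : E) : ∀ {a b : V}, QPath P.src P.tgt a b → A
  | _, _, .nil _ => 0
  | _, _, .cons (.nil _) β _ => if β = α then P.idem (P.tgt β) else 0
  | _, _, .cons (.cons p γ h) β _ => P.arrow β * removeFirst α (.cons p γ h)

theorem removeFirst_comp (α : E) {a b c : V} (p : QPath P.src P.tgt a b)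
    (q : QPath P.src P.tgt b c) (hp : 1 ≤ p.length) :
    P.removeFirst α (p.comp q) = P.qprod q * P.removeFirst α p := by
  have key : ∀ {x y : V} (r : QPath P.src P.tgt x y), 1 ≤ r.length →
      P.idem y * P.removeFirst α r = P.removeFirst α r := by
    intro x y r hr
    cases r with
    | nil => simp [QPath.length] at hr
    | cons r β h =>
      cases r with
      | nil =>
        rw [removeFirst]
        split_ifs
        · exact P.idem_idem _
        · exact mul_zero _
      | cons r γ h' => rw [removeFirst, ← mul_assoc, P.idem_tgt_mul_arrow]
  have hkey := key p hp
  clear key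
  induction q with
  | nil => rw [QPath.comp, qprod, hkey]
  | cons q β h ih =>
    have hpos : 1 ≤ (p.comp q).length := by rw [QPath.length_comp]; omega
    rw [QPath.comp, qprod, mul_assoc, ← ih]
    generalize p.comp q = r at hpos
    cases r with
    | nil => simp [QPath.length] at hpos
    | cons r γ h' => rw [removeFirst]

theorem removeFirst_eq (α : E) {a b : V} (p : QPath P.src P.tgt a b) (hp : 1 ≤ p.length) :
    P.removeFirst α p = 0 ∨ ∃ (h : P.src α = a) (q : QPath P.src P.tgt (P.tgt α) b),
      p = (QPath.cons (.nil a) α h).comp q ∧ P.removeFirst α p = P.qprod q := by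
  induction p with
  | nil => simp [QPath.length] at hp
  | cons p β h ih =>
    cases p with
    | nil =>
      by_cases hβ : β = α
      · subst hβ
        exact .inr ⟨h, .nil _, by rw [QPath.comp], by simp [removeFirst, qprod]⟩
      · exact .inl (by simp [removeFirst, hβ])
    | cons p γ h' =>
      obtain h0 | ⟨hα, q, hq, h1⟩ := ih (by simp [QPath.length])
      · exact .inl (by rw [removeFirst, h0, mul_zero])
      · refine .inr ⟨hα, .cons q β h, by rw [QPath.comp, hq], by rw [removeFirst, h1, qprod]⟩

theorem Monomial.exists_removeLast (hmono : P.Monomial) (α : E)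
    (hα : ¬ P.InvolvedInZeroRel (P.src α)) :
    ∃ R : A →ₗ[k] A, R (P.arrow α) = P.idem (P.src α) ∧
      ∀ x ∈ P.pathSpan 1, ∀ y, R (x * y) = R x * y := by
  obtain ⟨R, hR⟩ := hmono.exists_linearMap (P.removeLast α) (by
    intro a b p hp
    cases p with
    | nil => exact absurd (by rwa [qprod] at hp) (P.idem_ne a)
    | cons p β h =>
      rw [removeLast]
      split_ifs with hβ
      · subst hβ h
        by_contra h0
        have h1 : P.qprod (QPath.cons (.nil (P.src β)) β rfl) ≠ 0 := by
          rw [qprod, qprod, P.arrow_mul_idem_src]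
          exact P.arrow_ne β
        refine P.qprod_comp_ne_zero p _ hα h0 h1 ?_
        rwa [QPath.comp, QPath.comp]
      · rfl)
  refine ⟨R, ?_, fun x hx y => ?_⟩
  · have := hR _ _ (QPath.cons (.nil (P.src α)) α rfl)
    simpa [qprod, removeLast, P.arrow_mul_idem_src] using this
  · induction hx using Submodule.span_induction with
    | zero => simp
    | add x z _ _ hx hz => simp [add_mul, hx, hz]
    | smul t x _ hx => simp [hx]
    | mem x h =>
      obtain ⟨c, d, q, hq, rfl⟩ := h
      induction mem_pathSpan_zero (P := P) y using Submodule.span_induction with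
      | zero => simp
      | add x z _ _ hx hz => simp [mul_add, hx, hz]
      | smul t x _ hx => simp [hx]
      | mem y h =>
        obtain ⟨a, b, p, -, rfl⟩ := h
        cases q with
        | nil => simp [QPath.length] at hq
        | cons q β h =>
          by_cases hcb : c = b
          · subst hcb
            rw [← qprod_comp, hR, hR, QPath.comp, removeLast, removeLast]
            split_ifs
            · exact qprod_comp P p q
            · exact (zero_mul _).symm
          · rw [P.qprod_mul_qprod_of_ne _ _ hcb, map_zero, hR, removeLast]
            split_ifs
            · exact (P.qprod_mul_qprod_of_ne _ _ hcb).symm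
            · exact (zero_mul _).symm

theorem Monomial.exists_removeFirst (hmono : P.Monomial) (α : E)
    (hα : ¬ P.InvolvedInZeroRel (P.tgt α)) :
    ∃ L : A →ₗ[k] A, L (P.arrow α) = P.idem (P.tgt α) ∧
      ∀ x ∈ P.pathSpan 1, ∀ y, L (y * x) = y * L x := by
  have h1 : P.qprod (QPath.cons (.nil (P.src α)) α rfl) ≠ 0 := by
    rw [qprod, qprod, P.arrow_mul_idem_src]
    exact P.arrow_ne α
  obtain ⟨L, hL⟩ := hmono.exists_linearMap (P.removeFirst α) (by
    intro a b p hp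
    by_cases hlen : 1 ≤ p.length
    · obtain h | ⟨rfl, q, rfl, hq⟩ := removeFirst_eq α p hlen
      · exact h
      · by_contra h0
        exact P.qprod_comp_ne_zero _ q hα h1 (hq ▸ h0) hp
    · cases p with
      | nil => rw [removeFirst]
      | cons p β h => simp [QPath.length] at hlen)
  refine ⟨L, ?_, fun x hx y => ?_⟩
  · have := hL _ _ (QPath.cons (.nil (P.src α)) α rfl)
    simpa [qprod, removeFirst, P.arrow_mul_idem_src] using this
  · induction hx using Submodule.span_induction with
    | zero => simp
    | add x z _ _ hx hz => simp [mul_add, hx, hz]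
    | smul t x _ hx => simp [hx]
    | mem x h =>
      obtain ⟨a, b, p, hp, rfl⟩ := h
      induction mem_pathSpan_zero (P := P) y using Submodule.span_induction with
      | zero => simp
      | add x z _ _ hx hz => simp [add_mul, hx, hz]
      | smul t x _ hx => simp [hx]
      | mem y h =>
        obtain ⟨c, d, q, -, rfl⟩ := h
        by_cases hcb : c = b
        · subst hcb
          rw [← qprod_comp, hL, hL, removeFirst_comp α p q hp]
        · rw [P.qprod_mul_qprod_of_ne _ _ hcb, map_zero, hL]
          obtain h | ⟨rfl, r, -, hr⟩ := removeFirst_eq α p hp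
          · rw [h, mul_zero]
          · rw [hr, P.qprod_mul_qprod_of_ne _ _ hcb]

end QuiverPresentation

section Modules

variable {A : Type} [Ring A]

theorem IrrPath.append {M X N : ModuleCat.{0} A} {f : M ⟶ X} {g : X ⟶ N} {m n : ℕ}
    (hf : IrrPath A M X f m) (hg : IrrPath A X N g n) : IrrPath A M N (f ≫ g) (m + n) := by
  induction hf with
  | nil => simpa using hg
  | cons f f' m hM hirr _ ih =>
    rw [Category.assoc, Nat.add_right_comm]
    exact .cons f _ _ hM hirr (ih hg)

theorem IrredMor.of_iso {X Y X' Y' : ModuleCat.{0} A} {f : X ⟶ Y} (hf : IrredMor A f)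
    (e : X' ≅ X) (e' : Y ≅ Y') : IrredMor A (e.hom ≫ f ≫ e'.hom) := by
  obtain ⟨h1, h2, h3⟩ := hf
  refine ⟨fun ⟨g, hg⟩ => h1 ⟨e'.hom ≫ g ≫ e.hom, ?_⟩, fun ⟨g, hg⟩ => h2 ⟨e'.hom ≫ g ≫ e.hom, ?_⟩,
    fun Z hZ u v huv => ?_⟩
  · simpa using congrArg (fun t => e.inv ≫ t ≫ e.hom) hg
  · simpa using congrArg (fun t => e'.hom ≫ t ≫ e'.inv) hg
  · obtain ⟨r, hr⟩ | ⟨s, hs⟩ := h3 Z hZ (e.inv ≫ u) (v ≫ e'.inv) (by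
      simpa using congrArg (fun t => e.inv ≫ t ≫ e'.inv) huv)
    · refine .inl ⟨r ≫ e.inv, ?_⟩
      simpa using congrArg (fun t => e.hom ≫ t ≫ e.inv) hr
    · refine .inr ⟨e'.inv ≫ s, ?_⟩
      simpa using congrArg (fun t => e'.inv ≫ t ≫ e'.hom) hs

theorem Indec.eq_zero_or_eq_id {M : ModuleCat.{0} A} (hM : Indec A M) (f : M →ₗ[A] M)
    (hf : f ∘ₗ f = f) : f = 0 ∨ f = LinearMap.id := by
  obtain h | h := hM.2 (ModuleCat.ofHom f) (by rw [← ModuleCat.ofHom_comp, hf])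
  · exact .inl (congrArg ModuleCat.Hom.hom h)
  · exact .inr (congrArg ModuleCat.Hom.hom h)

/-- Fitting's lemma: an endomorphism of an indecomposable module of finite length is
nilpotent or bijective. -/
theorem Indec.bijective_of_not_isNilpotent {M : ModuleCat.{0} A} [IsArtinian A M]
    [IsNoetherian A M] (hM : Indec A M) (f : Module.End A M) (hf : ¬ IsNilpotent f) :
    Function.Bijective f := by
  obtain ⟨n, hn, hc⟩ := ((Filter.eventually_ge_atTop 1).and
    f.eventually_isCompl_ker_pow_range_pow).exists
  obtain h | h := hM.eq_zero_or_eq_id _ (Submodule.isIdempotentElem_projection hc.symm)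
  · refine absurd ⟨n, LinearMap.range_eq_bot.1 ?_⟩ hf
    rw [← Submodule.range_projection hc.symm, h, LinearMap.range_zero]
  · have hker : LinearMap.ker (f ^ n) = ⊥ := by
      rw [← Submodule.ker_projection hc.symm, h, LinearMap.ker_id]
    have hrange : LinearMap.range (f ^ n) = ⊤ := by
      rw [← Submodule.range_projection hc.symm, h, LinearMap.range_id]
    have hbij : Function.Bijective (f^[n]) := by
      rw [← Module.End.coe_pow]
      exact ⟨LinearMap.ker_eq_bot.1 hker, LinearMap.range_eq_top.1 hrange⟩
    obtain ⟨m, rfl⟩ := Nat.exists_eq_add_of_le' hn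
    exact ⟨.of_comp (f := f^[m]) (Function.iterate_succ f m ▸ hbij.1),
      .of_comp (g := f^[m]) (Function.iterate_succ' f m ▸ hbij.2)⟩

theorem not_isNilpotent_of_comp_eq_left {M N : Type} [AddCommGroup M] [Module A M]
    [AddCommGroup N] [Module A N] {f : Module.End A M} {g : M →ₗ[A] N} (hg : g ≠ 0)
    (h : g ∘ₗ f = g) : ¬ IsNilpotent f := by
  rintro ⟨n, hn⟩
  have key : ∀ m : ℕ, g ∘ₗ (f ^ m) = g := by
    intro m
    induction m with
    | zero => rfl
    | succ m ih => rw [pow_succ, Module.End.mul_eq_comp, ← LinearMap.comp_assoc, ih, h]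
  exact hg (by rw [← key n, hn, LinearMap.comp_zero])

theorem not_isNilpotent_of_comp_eq_right {M N : Type} [AddCommGroup M] [Module A M]
    [AddCommGroup N] [Module A N] {f : Module.End A M} {g : N →ₗ[A] M} (hg : g ≠ 0)
    (h : f ∘ₗ g = g) : ¬ IsNilpotent f := by
  rintro ⟨n, hn⟩
  have key : ∀ m : ℕ, (f ^ m) ∘ₗ g = g := by
    intro m
    induction m with
    | zero => rfl
    | succ m ih => rw [pow_succ, Module.End.mul_eq_comp, LinearMap.comp_assoc, h, ih]
  exact hg (by rw [← key n, hn, LinearMap.zero_comp])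

theorem FinIndec.nonempty_iso [IsArtinianRing A] {M N : ModuleCat.{0} A}
    (hM : FinIndec A M) (hN : FinIndec A N) (u : M →ₗ[A] N) (v : N →ₗ[A] M)
    (hvu : ¬ IsNilpotent (v ∘ₗ u : Module.End A M))
    (huv : ¬ IsNilpotent (u ∘ₗ v : Module.End A N)) : Nonempty (M ≅ N) := by
  have := hM.1
  have := hN.1
  have h1 := (hM.2.bijective_of_not_isNilpotent _ hvu).1
  have h2 := (hN.2.bijective_of_not_isNilpotent _ huv).2
  rw [LinearMap.coe_comp] at h1 h2
  exact ⟨(LinearEquiv.ofBijective u ⟨h1.of_comp, h2.of_comp⟩).toModuleIso⟩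

theorem nonempty_iso_of_projective [IsArtinianRing A] {M N : ModuleCat.{0} A} {S : Type}
    [AddCommGroup S] [Module A S] [Nontrivial S] (hM : FinIndec A M) (hN : FinIndec A N)
    [Module.Projective A M] [Module.Projective A N] (f : M →ₗ[A] S) (g : N →ₗ[A] S)
    (hf : Function.Surjective f) (hg : Function.Surjective g) : Nonempty (M ≅ N) := by
  obtain ⟨u, hu⟩ := Module.projective_lifting_property g f hg
  obtain ⟨v, hv⟩ := Module.projective_lifting_property f g hf
  have hf0 : f ≠ 0 := by
    rintro rfl
    obtain ⟨x, hx⟩ := exists_ne (0 : S)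
    obtain ⟨y, rfl⟩ := hf x
    exact hx rfl
  have hg0 : g ≠ 0 := by
    rintro rfl
    exact hf0 (by rw [← hu, LinearMap.zero_comp])
  exact hM.nonempty_iso hN u v
    (not_isNilpotent_of_comp_eq_left hf0 (by rw [← LinearMap.comp_assoc, hv, hu]))
    (not_isNilpotent_of_comp_eq_left hg0 (by rw [← LinearMap.comp_assoc, hu, hv]))

theorem nonempty_iso_of_injective [IsArtinianRing A] {M N : ModuleCat.{0} A} {S : Type}
    [AddCommGroup S] [Module A S] [Nontrivial S] (hM : FinIndec A M) (hN : FinIndec A N)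
    [hM' : Module.Injective A M] [hN' : Module.Injective A N] (f : S →ₗ[A] M) (g : S →ₗ[A] N)
    (hf : Function.Injective f) (hg : Function.Injective g) : Nonempty (M ≅ N) := by
  obtain ⟨u, hu⟩ := hN'.out f hf g
  obtain ⟨v, hv⟩ := hM'.out g hg f
  obtain ⟨x, hx⟩ := exists_ne (0 : S)
  have hf0 : f ≠ 0 := fun h => hx (hf (by rw [h, LinearMap.zero_apply, LinearMap.zero_apply]))
  have hg0 : g ≠ 0 := fun h => hx (hg (by rw [h, LinearMap.zero_apply, LinearMap.zero_apply]))
  exact hM.nonempty_iso hN u v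
    (not_isNilpotent_of_comp_eq_right hf0 (LinearMap.ext fun s => by simp [hu, hv]))
    (not_isNilpotent_of_comp_eq_right hg0 (LinearMap.ext fun s => by simp [hu, hv]))

end Modules

namespace QuiverPresentation

variable {k A V E : Type} [Field k] [Ring A] [Algebra k A] [Fintype V] [Fintype E]
variable {P : QuiverPresentation k A V E}

variable (P) in
/-- The projective module `A e_v`. -/
def projMod (v : V) : Submodule A A where
  carrier := {x | x * P.idem v = x}
  add_mem' hx hy := by
    rw [Set.mem_ofPred_eq] at hx hy ⊢
    rw [add_mul, hx, hy]
  zero_mem' := zero_mul _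
  smul_mem' c x hx := by
    rw [Set.mem_ofPred_eq] at hx ⊢
    rw [smul_eq_mul, mul_assoc, hx]

theorem mem_projMod {v : V} {x : A} : x ∈ P.projMod v ↔ x * P.idem v = x := Iff.rfl

theorem idem_mem_projMod (v : V) : P.idem v ∈ P.projMod v := P.idem_idem v

variable (P) in
/-- The generator `e_v` of `A e_v`. -/
def projGen (v : V) : P.projMod v := ⟨P.idem v, idem_mem_projMod v⟩

theorem smul_projGen {v : V} (x : P.projMod v) : (x : A) • P.projGen v = x :=
  Subtype.ext x.2

variable (P) in
/-- Right multiplication by `e_v`. -/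
def toProjMod (v : V) : A →ₗ[A] P.projMod v := LinearMap.toSpanSingleton A _ (P.projGen v)

theorem toProjMod_coe {v : V} (x : P.projMod v) : P.toProjMod v x = x := smul_projGen x

instance projective_projMod (v : V) : Module.Projective A (P.projMod v) :=
  .of_split (P.projMod v).subtype (P.toProjMod v) (LinearMap.ext toProjMod_coe)

theorem finIndec_projMod (v : V) : FinIndec A (ModuleCat.of A (P.projMod v)) := by
  refine ⟨.of_surjective (P.toProjMod v) fun x => ⟨x, toProjMod_coe x⟩,
    ⟨P.projGen v, 0, fun h => P.idem_ne v (congrArg Subtype.val h)⟩, fun f hf => ?_⟩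
  let F : P.projMod v →ₗ[A] P.projMod v := f.hom
  have hF : F ∘ₗ F = F := congrArg ModuleCat.Hom.hom hf
  have hFx : ∀ x, F x = (x : A) • F (P.projGen v) := fun x => by
    rw [← map_smul, smul_projGen]
  set g : P.projMod v := F (P.projGen v)
  have heg : P.idem v * (g : A) = g := congrArg Subtype.val (hFx (P.projGen v)).symm
  have hge : (g : A) * P.idem v = g := g.2
  have hgg : (g : A) * g = g :=
    congrArg Subtype.val ((hFx g).symm.trans (LinearMap.congr_fun hF (P.projGen v)))
  have hext : ∀ G : P.projMod v →ₗ[A] P.projMod v, F (P.projGen v) = G (P.projGen v) →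
      f = ModuleCat.ofHom G := by
    intro G h
    refine ModuleCat.hom_ext (LinearMap.ext fun x => ?_)
    show F x = G x
    rw [← smul_projGen x, map_smul, map_smul, h]
  obtain h | h := P.idem_primitive v g (P.idem v - g) hgg
    (by rw [sub_mul, mul_sub, mul_sub, P.idem_idem, heg, hge, hgg, sub_self, sub_zero])
    (by rw [mul_sub, hge, hgg, sub_self]) (by rw [sub_mul, heg, hgg, sub_self])
    (add_sub_cancel _ _)
  · exact .inl (hext 0 (Subtype.ext h))
  · exact .inr (hext .id (Subtype.ext (sub_eq_zero.1 h).symm))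

theorem nonempty_iso_projMod [FiniteDimensional k A] {v : V} {M : ModuleCat.{0} A}
    (hM : IsProjAt P v M) : Nonempty (M ≅ ModuleCat.of A (P.projMod v)) := by
  obtain ⟨hproj, hfin, S, f, ⟨hS, x, hx⟩, hf⟩ := hM
  have := IsArtinianRing.of_finite k A
  have := hS.nontrivial
  have : Module.Projective A (ModuleCat.of A (P.projMod v)) :=
    inferInstanceAs (Module.Projective A (P.projMod v))
  let g : P.projMod v →ₗ[A] S := LinearMap.toSpanSingleton A S x ∘ₗ (P.projMod v).subtype
  refine nonempty_iso_of_projective hfin (finIndec_projMod v) f.hom g hf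
    (LinearMap.surjective_of_ne_zero fun h => hx ?_)
  exact LinearMap.congr_fun h (P.projGen v)

/-- The arrow ideal contains every proper submodule of `A e_v`. -/
theorem Admissible.projMod_local (hadm : P.Admissible) {v : V} {N : Submodule A A}
    (hv : P.idem v ∉ N) {x : A} (hx : x ∈ N) (hxv : x ∈ P.projMod v) : x ∈ P.pathSpan 1 := by
  obtain ⟨c, hc⟩ := exists_mul_idem_sub_mem (P := P) v x
  rw [mem_projMod.1 hxv] at hc
  by_cases hc0 : c = 0
  · simpa [hc0] using hc
  exfalso
  set j := x - c • P.idem v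
  have hj : IsNilpotent (-(c⁻¹ • j)) :=
    hadm.isNilpotent (neg_mem (Submodule.smul_mem _ _ hc))
  obtain ⟨w, hw⟩ := hj.isUnit_one_sub.exists_left_inv
  have hx' : (1 - -(c⁻¹ • j)) * P.idem v = algebraMap k A c⁻¹ * x := by
    rw [sub_neg_eq_add, add_mul, one_mul, smul_mul_assoc, sub_mul, mem_projMod.1 hxv,
      smul_mul_assoc, P.idem_idem, smul_sub, smul_smul, inv_mul_cancel₀ hc0, one_smul,
      add_sub_cancel, Algebra.smul_def]
  refine hv ?_
  rw [← one_mul (P.idem v), ← hw, mul_assoc, hx', ← mul_assoc]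
  exact N.smul_mem _ hx

/-- Right multiplication by an arrow which ends at a vertex not involved in a zero-relation
is an irreducible morphism between indecomposable projectives. -/
theorem exists_irredMor_projMod (hadm : P.Admissible) (hmono : P.Monomial) (α : E)
    (hα : ¬ P.InvolvedInZeroRel (P.tgt α)) :
    ∃ f : ModuleCat.of A (P.projMod (P.tgt α)) ⟶ ModuleCat.of A (P.projMod (P.src α)),
      IrredMor A f := by
  obtain ⟨L, hLα, hL⟩ := hmono.exists_removeFirst α hα
  have hαJ : P.arrow α ∈ P.pathSpan 1 := arrow_mem_pathSpan α
  let f : P.projMod (P.tgt α) →ₗ[A] P.projMod (P.src α) :=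
    LinearMap.toSpanSingleton A _ ⟨P.arrow α, P.arrow_mul_idem_src α⟩ ∘ₗ Submodule.subtype _
  have hf : ∀ x, (f x : A) = x * P.arrow α := fun _ => rfl
  refine ⟨ModuleCat.ofHom f, ?_, ?_, fun Z _ u v huv => ?_⟩
  · rintro ⟨g, hg⟩
    let G : P.projMod (P.src α) →ₗ[A] P.projMod (P.tgt α) := g.hom
    have hGf : G (f (P.projGen (P.tgt α))) = P.projGen (P.tgt α) :=
      LinearMap.congr_fun (congrArg ModuleCat.Hom.hom hg) _
    have hfe : f (P.projGen (P.tgt α)) = P.arrow α • P.projGen (P.src α) :=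
      Subtype.ext ((P.idem_tgt_mul_arrow α).trans (P.arrow_mul_idem_src α).symm)
    rw [hfe, map_smul] at hGf
    refine hadm.idem_notMem (P.tgt α) ?_
    rw [← show P.arrow α * (G (P.projGen (P.src α)) : A) = P.idem (P.tgt α) from
      congrArg Subtype.val hGf]
    exact mem_pathSpan_mul _ hαJ
  · rintro ⟨g, hg⟩
    let G : P.projMod (P.src α) →ₗ[A] P.projMod (P.tgt α) := g.hom
    have hfG : f (G (P.projGen (P.src α))) = P.projGen (P.src α) :=
      LinearMap.congr_fun (congrArg ModuleCat.Hom.hom hg) _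
    refine hadm.idem_notMem (P.src α) ?_
    rw [← show (G (P.projGen (P.src α)) : A) * P.arrow α = P.idem (P.src α) from
      congrArg Subtype.val hfG]
    exact mul_mem_pathSpan _ hαJ
  · let v' : Z →ₗ[A] P.projMod (P.src α) := v.hom
    let u' : P.projMod (P.tgt α) →ₗ[A] Z := u.hom
    have huv' : ∀ x, v' (u' x) = f x := fun x =>
      (LinearMap.congr_fun (congrArg ModuleCat.Hom.hom huv) x).symm
    by_cases hsurj : Function.Surjective v'
    · obtain ⟨s, hs⟩ := Module.projective_lifting_property v' LinearMap.id hsurj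
      exact .inr ⟨ModuleCat.ofHom s, ModuleCat.hom_ext hs⟩
    have hJ : ∀ z, (v' z : A) ∈ P.pathSpan 1 := by
      intro z
      refine hadm.projMod_local (N := (LinearMap.range v').map (Submodule.subtype _)) ?_
        ⟨v' z, ⟨z, rfl⟩, rfl⟩ (v' z).2
      rintro ⟨y, ⟨z, hz⟩, hy⟩
      have hgen : v' z = P.projGen (P.src α) := Subtype.ext ((congrArg Subtype.val hz).trans hy)
      refine hsurj fun x => ⟨(x : A) • z, ?_⟩
      rw [map_smul, hgen, smul_projGen]
    let r : Z →ₗ[A] A :=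
      { toFun := fun z => L (v' z)
        map_add' := fun y z => by rw [map_add, Submodule.coe_add, map_add]
        map_smul' := fun c z => by
          rw [map_smul, Submodule.coe_smul, smul_eq_mul, hL _ (hJ z)]
          rfl }
    refine .inl ⟨ModuleCat.ofHom (P.toProjMod (P.tgt α) ∘ₗ r), ModuleCat.hom_ext ?_⟩
    refine LinearMap.ext fun x => ?_
    have hr : r (u' x) = x := by
      show L (v' (u' x)) = x
      rw [huv', hf, hL _ hαJ, hLα]
      exact x.2
    exact (congrArg (P.toProjMod (P.tgt α)) hr).trans (toProjMod_coe x)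

/-- The `k`-dual of `A`, as a left `A`-module. -/
def DualMod (k A : Type) [Field k] [Ring A] [Algebra k A] : Type := A →ₗ[k] k

namespace DualMod

instance : AddCommGroup (DualMod k A) := inferInstanceAs (AddCommGroup (A →ₗ[k] k))

instance : Module k (DualMod k A) := inferInstanceAs (Module k (A →ₗ[k] k))

instance : FunLike (DualMod k A) A k := inferInstanceAs (FunLike (A →ₗ[k] k) A k)

instance : LinearMapClass (DualMod k A) k A k :=
  inferInstanceAs (LinearMapClass (A →ₗ[k] k) k A k)

instance [FiniteDimensional k A] : FiniteDimensional k (DualMod k A) :=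
  inferInstanceAs (FiniteDimensional k (A →ₗ[k] k))

instance : SMul A (DualMod k A) := ⟨fun a φ => LinearMap.comp φ (LinearMap.mulRight k a)⟩

theorem smul_apply (a : A) (φ : DualMod k A) (x : A) : (a • φ) x = φ (x * a) := rfl

theorem add_apply (φ ψ : DualMod k A) (x : A) : (φ + ψ) x = φ x + ψ x := rfl

theorem zero_apply (x : A) : (0 : DualMod k A) x = 0 := rfl

theorem base_smul_apply (c : k) (φ : DualMod k A) (x : A) : (c • φ) x = c * φ x := rfl

theorem ext {φ ψ : DualMod k A} (h : ∀ x, φ x = ψ x) : φ = ψ := DFunLike.ext _ _ h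

instance : Module A (DualMod k A) where
  one_smul φ := ext fun x => by rw [smul_apply, mul_one]
  mul_smul a b φ := ext fun x => by rw [smul_apply, smul_apply, smul_apply, mul_assoc]
  smul_zero a := rfl
  smul_add a φ ψ := rfl
  add_smul a b φ := ext fun x => by
    rw [smul_apply, add_apply, smul_apply, smul_apply, mul_add, map_add]
  zero_smul φ := ext fun x => by rw [smul_apply, mul_zero, map_zero, zero_apply]

instance : IsScalarTower k A (DualMod k A) :=
  ⟨fun c a φ => ext fun x => by
    rw [smul_apply, base_smul_apply, smul_apply, mul_smul_comm, map_smul, smul_eq_mul]⟩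

end DualMod

variable (P) in
/-- The injective module `D(e_v A)`. -/
def injMod (v : V) : Submodule A (DualMod k A) where
  carrier := {φ | ∀ x, φ (P.idem v * x) = φ x}
  add_mem' hφ hψ x := by rw [DualMod.add_apply, DualMod.add_apply, hφ, hψ]
  zero_mem' _ := rfl
  smul_mem' c φ hφ x := by rw [DualMod.smul_apply, DualMod.smul_apply, mul_assoc, hφ]

theorem injMod_ext {v : V} {φ ψ : P.injMod v} (h : ∀ x, φ.1 x = ψ.1 x) : φ = ψ :=
  Subtype.ext (DualMod.ext h)

variable (P) in
/-- The morphism to `D(e_v A)` induced by a linear form. -/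
def toInjMod (v : V) {M : Type} [AddCommGroup M] [Module A M] [Module k M]
    [IsScalarTower k A M] (H : M →ₗ[k] k) : M →ₗ[A] P.injMod v where
  toFun y := ⟨H ∘ₗ (LinearMap.toSpanSingleton A M y).restrictScalars k ∘ₗ
    LinearMap.mulLeft k (P.idem v), fun x => by
      show H ((P.idem v * (P.idem v * x)) • y) = H ((P.idem v * x) • y)
      rw [← mul_assoc, P.idem_idem]⟩
  map_add' y z := injMod_ext fun x => by
    show H ((P.idem v * x) • (y + z)) = H ((P.idem v * x) • y) + H ((P.idem v * x) • z)
    rw [smul_add, map_add]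
  map_smul' c y := injMod_ext fun x => by
    show H ((P.idem v * x) • c • y) = H ((P.idem v * (x * c)) • y)
    rw [smul_smul, mul_assoc]

theorem toInjMod_apply (v : V) {M : Type} [AddCommGroup M] [Module A M] [Module k M]
    [IsScalarTower k A M] (H : M →ₗ[k] k) (y : M) (x : A) :
    (P.toInjMod v H y).1 x = H ((P.idem v * x) • y) := rfl

instance injective_injMod (v : V) : Module.Injective A (P.injMod v) := by
  refine ⟨fun X Y _ _ _ _ f hf g => ?_⟩
  let : Module k X := Module.compHom X (algebraMap k A)
  let : Module k Y := Module.compHom Y (algebraMap k A)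
  have tower : ∀ (Z : Type) [AddCommGroup Z] [Module A Z],
      @IsScalarTower k A Z _ _ (Module.compHom Z (algebraMap k A)).toSMul := fun Z _ _ =>
    let : Module k Z := Module.compHom Z (algebraMap k A)
    ⟨fun c a z => by rw [Algebra.smul_def, mul_smul]; rfl⟩
  have := tower X
  have := tower Y
  obtain ⟨r, hr⟩ := (f.restrictScalars k).exists_leftInverse_of_injective
    (LinearMap.ker_eq_bot.2 hf)
  let G : X →ₗ[k] k :=
    { toFun := fun x => (g x).1 1
      map_add' := fun x y => by rw [map_add]; rfl
      map_smul' := fun c x => by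
        rw [← algebraMap_smul A c x, map_smul, Submodule.coe_smul, DualMod.smul_apply, one_mul,
          Algebra.algebraMap_eq_smul_one, map_smul]
        rfl }
  refine ⟨P.toInjMod v (G ∘ₗ r), fun x => injMod_ext fun t => ?_⟩
  rw [toInjMod_apply, ← map_smul]
  have : r (f ((P.idem v * t) • x)) = (P.idem v * t) • x := LinearMap.congr_fun hr _
  show (g (r (f ((P.idem v * t) • x)))).1 1 = (g x).1 t
  rw [this, map_smul, Submodule.coe_smul, DualMod.smul_apply, one_mul, (g x).2]

/-- The simple socle of `D(e_v A)` lies in every non-zero submodule. -/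
theorem Admissible.mem_of_socle (hadm : P.Admissible) {v : V} {N : Submodule A (P.injMod v)}
    (hN : N ≠ ⊥) {φ : P.injMod v} (hφ : ∀ x ∈ P.pathSpan 1, φ.1 x = 0) : φ ∈ N := by
  obtain ⟨ψ, hψN, hψ0, hψ⟩ := hadm.exists_mul_eq_zero hN
  have key : ∀ χ : P.injMod v, (∀ x ∈ P.pathSpan 1, χ.1 x = 0) → ∀ (x : A) (c : k),
      P.idem v * x - c • P.idem v ∈ P.pathSpan 1 → χ.1 x = c * χ.1 (P.idem v) := by
    intro χ hχ x c hc
    have := hχ _ hc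
    rw [map_sub, map_smul, χ.2, sub_eq_zero] at this
    exact this
  have hψ' : ∀ x ∈ P.pathSpan 1, ψ.1 x = 0 := fun x hx => by
    have : (x • ψ).1 1 = 0 := by rw [hψ x hx]; rfl
    rwa [Submodule.coe_smul, DualMod.smul_apply, one_mul] at this
  have hne : ψ.1 (P.idem v) ≠ 0 := fun h => hψ0 <| injMod_ext fun x => by
    obtain ⟨c, hc⟩ := exists_idem_mul_sub_mem (P := P) v x
    rw [key ψ hψ' x c hc, h, mul_zero]
    rfl
  have hφψ : φ = (φ.1 (P.idem v) / ψ.1 (P.idem v)) • ψ := injMod_ext fun x => by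
    obtain ⟨c, hc⟩ := exists_idem_mul_sub_mem (P := P) v x
    show φ.1 x = (φ.1 (P.idem v) / ψ.1 (P.idem v)) * ψ.1 x
    rw [key φ hφ x c hc, key ψ hψ' x c hc]
    field_simp
  rw [hφψ]
  exact N.smul_of_tower_mem _ hψN

theorem Admissible.exists_socle (hadm : P.Admissible) (v : V) :
    ∃ φ : P.injMod v, φ ≠ 0 ∧ ∀ x ∈ P.pathSpan 1, φ.1 x = 0 := by
  obtain ⟨F, hF, hker⟩ := Submodule.exists_le_ker_of_notMem (hadm.idem_notMem v)
  refine ⟨P.toInjMod v F 1, fun h => hF ?_, fun x hx => ?_⟩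
  · have : (P.toInjMod v F 1).1 1 = 0 := by rw [h]; rfl
    rwa [toInjMod_apply, mul_one, smul_eq_mul, mul_one] at this
  · rw [toInjMod_apply, smul_eq_mul, mul_one]
    exact hker (mul_mem_pathSpan _ hx)

theorem finIndec_injMod [FiniteDimensional k A] (hadm : P.Admissible) (v : V) :
    FinIndec A (ModuleCat.of A (P.injMod v)) := by
  obtain ⟨φ, hφ0, hφ⟩ := hadm.exists_socle v
  have hfin : Module.Finite k (P.injMod v) :=
    .of_injective ((P.injMod v).subtype.restrictScalars k) Subtype.val_injective
  refine ⟨.of_restrictScalars_finite k A (P.injMod v), ⟨φ, 0, hφ0⟩, fun f hf => ?_⟩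
  let F : P.injMod v →ₗ[A] P.injMod v := f.hom
  have hF : ∀ x, F (F x) = F x := LinearMap.congr_fun (congrArg ModuleCat.Hom.hom hf)
  by_cases hker : LinearMap.ker F = ⊥
  · refine .inr (ModuleCat.hom_ext (LinearMap.ext fun x => ?_))
    exact LinearMap.ker_eq_bot.1 hker (hF x)
  by_cases hrange : LinearMap.range F = ⊥
  · exact .inl (ModuleCat.hom_ext (LinearMap.range_eq_bot.1 hrange))
  · have h1 : F φ = 0 := hadm.mem_of_socle hker hφ
    obtain ⟨ψ, hψ⟩ := hadm.mem_of_socle hrange hφ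
    rw [← hψ, hF, hψ] at h1
    exact absurd h1 hφ0

theorem nonempty_iso_injMod [FiniteDimensional k A] (hadm : P.Admissible) {v : V}
    {M : ModuleCat.{0} A} (hM : IsInjAt P v M) :
    Nonempty (M ≅ ModuleCat.of A (P.injMod v)) := by
  obtain ⟨hinj, hfin, S, f, ⟨hS, x, hx⟩, hf⟩ := hM
  have := IsArtinianRing.of_finite k A
  have := hS.nontrivial
  have : Module.Injective A (ModuleCat.of A (P.injMod v)) :=
    inferInstanceAs (Module.Injective A (P.injMod v))
  let : Module k S := Module.compHom S (algebraMap k A)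
  have : IsScalarTower k A S := ⟨fun c a z => by rw [Algebra.smul_def, mul_smul]; rfl⟩
  obtain ⟨H, hH, -⟩ := Submodule.exists_le_ker_of_notMem
    (show P.idem v • x ∉ (⊥ : Submodule k S) from hx)
  refine nonempty_iso_of_injective hfin (finIndec_injMod hadm v) f.hom (P.toInjMod v H) hf
    (LinearMap.injective_of_ne_zero fun h => hH ?_)
  have h1 : (P.toInjMod v H x).1 1 = 0 := by rw [h]; rfl
  rwa [toInjMod_apply, mul_one] at h1

/-- The morphism dual to left multiplication by an arrow which starts at a vertex not involved
in a zero-relation is an irreducible morphism between indecomposable injectives. -/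
theorem exists_irredMor_injMod (hadm : P.Admissible) (hmono : P.Monomial) (α : E)
    (hα : ¬ P.InvolvedInZeroRel (P.src α)) :
    ∃ f : ModuleCat.of A (P.injMod (P.tgt α)) ⟶ ModuleCat.of A (P.injMod (P.src α)),
      IrredMor A f := by
  obtain ⟨R, hRα, hR⟩ := hmono.exists_removeLast α hα
  have hαJ : P.arrow α ∈ P.pathSpan 1 := arrow_mem_pathSpan α
  let f : P.injMod (P.tgt α) →ₗ[A] P.injMod (P.src α) :=
    { toFun := fun φ => ⟨LinearMap.comp φ.1 (LinearMap.mulLeft k (P.arrow α)), fun x => by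
        show φ.1 (P.arrow α * (P.idem (P.src α) * x)) = φ.1 (P.arrow α * x)
        rw [← mul_assoc, P.arrow_mul_idem_src]⟩
      map_add' := fun φ ψ => rfl
      map_smul' := fun c φ => injMod_ext fun x => by
        show φ.1 (P.arrow α * x * c) = φ.1 (P.arrow α * (x * c))
        rw [mul_assoc] }
  have hf : ∀ φ x, (f φ).1 x = φ.1 (P.arrow α * x) := fun _ _ => rfl
  have hfsoc : ∀ φ : P.injMod (P.tgt α), (∀ x ∈ P.pathSpan 1, φ.1 x = 0) → f φ = 0 :=
    fun φ hφ => injMod_ext fun x => hφ _ (mem_pathSpan_mul x hαJ)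
  refine ⟨ModuleCat.ofHom f, ?_, ?_, fun Z _ u v huv => ?_⟩
  · rintro ⟨g, hg⟩
    let G : P.injMod (P.src α) →ₗ[A] P.injMod (P.tgt α) := g.hom
    have hGf : ∀ φ, G (f φ) = φ := LinearMap.congr_fun (congrArg ModuleCat.Hom.hom hg)
    obtain ⟨φ, hφ0, hφ⟩ := hadm.exists_socle (P.tgt α)
    exact hφ0 (by rw [← hGf φ, hfsoc φ hφ, map_zero])
  · rintro ⟨g, hg⟩
    let G : P.injMod (P.src α) →ₗ[A] P.injMod (P.tgt α) := g.hom
    have hfG : ∀ φ, f (G φ) = φ := LinearMap.congr_fun (congrArg ModuleCat.Hom.hom hg)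
    obtain ⟨φ, hφ0, hφ⟩ := hadm.exists_socle (P.src α)
    refine hφ0 ((hfG φ).symm.trans (hfsoc (G φ) fun x hx => ?_))
    have hxφ : x • φ = 0 := injMod_ext fun y => hφ _ (mul_mem_pathSpan y hx)
    have : (x • G φ).1 1 = 0 := by rw [← map_smul, hxφ, map_zero]; rfl
    rwa [Submodule.coe_smul, DualMod.smul_apply, one_mul] at this
  · let u' : P.injMod (P.tgt α) →ₗ[A] Z := u.hom
    let v' : Z →ₗ[A] P.injMod (P.src α) := v.hom
    have huv' : ∀ φ, v' (u' φ) = f φ := fun φ =>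
      (LinearMap.congr_fun (congrArg ModuleCat.Hom.hom huv) φ).symm
    by_cases hker : LinearMap.ker u' = ⊥
    · obtain ⟨r, hr⟩ := (injective_injMod (P := P) (P.tgt α)).out u'
        (LinearMap.ker_eq_bot.1 hker) LinearMap.id
      exact .inl ⟨ModuleCat.ofHom r, ModuleCat.hom_ext (LinearMap.ext hr)⟩
    have husoc : ∀ φ : P.injMod (P.tgt α), (∀ x ∈ P.pathSpan 1, φ.1 x = 0) → u' φ = 0 :=
      fun φ hφ => hadm.mem_of_socle hker hφ
    let s : P.injMod (P.src α) → P.injMod (P.tgt α) := fun φ =>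
      ⟨LinearMap.comp φ.1 (R ∘ₗ LinearMap.mulLeft k (P.idem (P.tgt α))), fun x => by
        show φ.1 (R (P.idem (P.tgt α) * (P.idem (P.tgt α) * x))) =
          φ.1 (R (P.idem (P.tgt α) * x))
        rw [← mul_assoc, P.idem_idem]⟩
    have hs : ∀ φ x, (s φ).1 x = φ.1 (R (P.idem (P.tgt α) * x)) := fun _ _ => rfl
    let w : P.injMod (P.src α) →ₗ[A] Z :=
      { toFun := fun φ => u' (s φ)
        map_add' := fun φ ψ => map_add u' (s φ) (s ψ)
        map_smul' := fun c φ => by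
          rw [RingHom.id_apply, ← map_smul, ← sub_eq_zero, ← map_sub]
          refine husoc _ fun x hx => ?_
          show φ.1 (R (P.idem (P.tgt α) * x) * c) -
            φ.1 (R (P.idem (P.tgt α) * (x * c))) = 0
          rw [← mul_assoc, hR _ (mul_mem_pathSpan _ hx), sub_self] }
    refine .inr ⟨ModuleCat.ofHom w, ModuleCat.hom_ext (LinearMap.ext fun φ => ?_)⟩
    show v' (u' (s φ)) = φ
    refine injMod_ext fun x => ?_
    rw [huv', hf, hs, ← mul_assoc, P.idem_tgt_mul_arrow, hR _ hαJ, hRα, φ.2]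

end QuiverPresentation

/-- If `A` is a representation-finite monomial algebra whose Auslander-Reiten quiver is a
component with length, `a` and `b` are not involved in any zero-relation, and there is
an arrow from `a` to `b`, then `r_a = r_b`. -/
theorem rval_eq_of_arrow_not_involved (k A : Type) [Field k] [IsAlgClosed k] [Ring A] [Algebra k A]
    [FiniteDimensional k A] (V E : Type) [Fintype V] [Fintype E]
    (P : QuiverPresentation k A V E) (hadm : P.Admissible) (hmin : P.Minimal)
    (hmono : P.Monomial) (hrf : RepFinite A) (hwl : WithLength A)
    (a b : V) (ha : ¬ P.InvolvedInZeroRel a) (hb : ¬ P.InvolvedInZeroRel b)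
    (harr : ∃ α : E, P.src α = a ∧ P.tgt α = b)
    (na nb : ℕ) (hna : RVal P a na) (hnb : RVal P b nb) :
    na = nb := by
  obtain ⟨α, rfl, rfl⟩ := harr
  obtain ⟨Pa, Sa, Ia, _, _, m₁, m₂, hPa, -, hIa, hm₁, hm₂, -, rfl⟩ := hna
  obtain ⟨Pb, Sb, Ib, _, _, n₁, n₂, hPb, -, hIb, hn₁, hn₂, -, rfl⟩ := hnb
  obtain ⟨ePa⟩ := QuiverPresentation.nonempty_iso_projMod hPa
  obtain ⟨ePb⟩ := QuiverPresentation.nonempty_iso_projMod hPb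
  obtain ⟨eIa⟩ := QuiverPresentation.nonempty_iso_injMod hadm hIa
  obtain ⟨eIb⟩ := QuiverPresentation.nonempty_iso_injMod hadm hIb
  obtain ⟨f, hf⟩ := QuiverPresentation.exists_irredMor_projMod hadm hmono α hb
  obtain ⟨g, hg⟩ := QuiverPresentation.exists_irredMor_injMod hadm hmono α ha
  have h := hwl Pb Ia _ _
    ⟨_, .cons _ _ _ hPb.2.1 (hf.of_iso ePb ePa.symm) (hm₁.append hm₂)⟩
    ⟨_, (hn₁.append hn₂).append
      (.cons _ _ _ hIb.2.1 (hg.of_iso eIb eIa.symm) (.nil Ia hIa.2.1))⟩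
  omega
end

section
/- Let A ≅ kQ_A/I_A be a representation-finite toupie algebra with exactly two branches of lengths n_1 and n_2 with n_2 ≥ n_1 (so the branches have n_1 and n_2 intermediate vertices), and I_A generated by the single commutative relation equating the two branch paths. Then the nilpotency index of Re(mod A) equals n_1 + 2n_2 + 2. -/
open CategoryTheory
open scoped Classical

/-- Arrow endpoints of the toupie quiver with two branches. -/
def toupie2Ends (n1 n2 : ℕ) : Fin (n1 + n2 + 2) → ℕ × ℕ := fun i =>
  let B := n1 + n2 + 1
  if (i : ℕ) ≤ n1 then
    (if (i : ℕ) = 0 then 0 else (i : ℕ), if (i : ℕ) = n1 then B else (i : ℕ) + 1)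
  else
    (if (i : ℕ) = n1 + 1 then 0 else (i : ℕ) - 1, if (i : ℕ) = n1 + n2 + 1 then B else (i : ℕ))


/-! ## Thin interval modules -/

namespace QuiverPresentation

variable {k A V E : Type} [Field k] [Ring A] [Algebra k A] [Fintype V] [Fintype E]

theorem idem_mul_arrow (P : QuiverPresentation k A V E) (α : E) :
    P.idem (P.tgt α) * P.arrow α = P.arrow α := by
  conv_lhs => rw [← P.arrow_mem α]
  rw [← mul_assoc, ← mul_assoc, P.idem_idem, P.arrow_mem]

theorem arrow_mul_idem (P : QuiverPresentation k A V E) (α : E) :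
    P.arrow α * P.idem (P.src α) = P.arrow α := by
  conv_lhs => rw [← P.arrow_mem α]
  rw [mul_assoc, P.idem_idem, P.arrow_mem]

/-- A `k`-linear map commuting with the idempotents and the arrows is `A`-linear. -/
theorem map_smul_of_generators (P : QuiverPresentation k A V E) {M N : Type}
    [AddCommGroup M] [AddCommGroup N] [Module A M] [Module A N] [Module k M] [Module k N]
    [IsScalarTower k A M] [IsScalarTower k A N] (θ : M →ₗ[k] N)
    (hidem : ∀ v x, θ (P.idem v • x) = P.idem v • θ x)
    (harrow : ∀ α x, θ (P.arrow α • x) = P.arrow α • θ x) (a : A) (x : M) :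
    θ (a • x) = a • θ x := by
  have ha : a ∈ Algebra.adjoin k (Set.range P.idem ∪ Set.range P.arrow) := by
    rw [P.generates]; trivial
  induction ha using Algebra.adjoin_induction generalizing x with
  | mem a ha =>
    rcases ha with ⟨v, rfl⟩ | ⟨α, rfl⟩
    · exact hidem v x
    · exact harrow α x
  | algebraMap r => simp
  | add a b _ _ iha ihb => simp [add_smul, iha, ihb]
  | mul a b _ _ iha ihb => simp [mul_smul, iha, ihb]

/-- A representation of `A` which is one-dimensional at every vertex and on which every arrow
acts as the identity of `k`. -/
structure Thin (P : QuiverPresentation k A V E) where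
  rep : A →ₐ[k] Module.End k (V → k)
  rep_idem : ∀ v f, rep (P.idem v) f = Pi.single v (f v)
  rep_arrow : ∀ α f, rep (P.arrow α) f = Pi.single (P.tgt α) (f (P.src α))

/-- A convex set of vertices, given as the intersection of a set closed under successors and a
set closed under predecessors. -/
structure Interval (P : QuiverPresentation k A V E) where
  up : Set V
  down : Set V
  up_closed : ∀ α, P.src α ∈ up → P.tgt α ∈ up
  down_closed : ∀ α, P.tgt α ∈ down → P.src α ∈ down

/-- The vertices of an interval. -/
def Interval.verts {P : QuiverPresentation k A V E} (I : P.Interval) : Set V := I.up ∩ I.down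

namespace Thin

variable {P : QuiverPresentation k A V E}

/-- A thin representation exists as soon as there is an element of `A` at every vertex such that
the arrows carry these elements to one another. -/
theorem nonempty_of_elements (w : V → A) (hne : ∀ v, w v ≠ 0)
    (hidem : ∀ v, P.idem v * w v = w v)
    (harrow : ∀ α, P.arrow α * w (P.src α) = w (P.tgt α)) : Nonempty P.Thin := by
  have horth : ∀ u v, P.idem u * w v = if u = v then w v else 0 := by
    intro u v
    split_ifs with h
    · rw [h, hidem]
    · rw [← hidem v, ← mul_assoc, P.idem_orth u v h, zero_mul]
  let Φ : (V → k) →ₗ[k] A := Fintype.linearCombination k w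
  have hΦ : ∀ f, Φ f = ∑ v, f v • w v := fun f => Fintype.linearCombination_apply k w f
  have hcoord : ∀ f v, P.idem v * Φ f = f v • w v := by
    intro f v
    simp [hΦ, Finset.mul_sum, horth]
  have hinj : LinearMap.ker Φ = ⊥ := by
    rw [LinearMap.ker_eq_bot']
    intro f hf
    funext v
    have := hcoord f v
    rw [hf, mul_zero] at this
    exact (smul_eq_zero.mp this.symm).resolve_right (hne v)
  have hΦinj : Function.Injective Φ := LinearMap.ker_eq_bot.mp hinj
  obtain ⟨Ψ, hΨ⟩ := Φ.exists_leftInverse_of_injective hinj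
  have hΨ' : ∀ f, Ψ (Φ f) = f := fun f => LinearMap.congr_fun hΨ f
  have hsingle : ∀ v c, Φ (Pi.single v c) = c • w v := by
    intro v c
    simp [hΦ, Pi.single_apply]
  have hi : ∀ v f, P.idem v * Φ f = Φ (Pi.single v (f v)) := by
    intro v f
    rw [hcoord, hsingle]
  have ha : ∀ α f, P.arrow α * Φ f = Φ (Pi.single (P.tgt α) (f (P.src α))) := by
    intro α f
    rw [← P.arrow_mul_idem α, mul_assoc, hcoord, mul_smul_comm, harrow, hsingle]
  have hstable : ∀ (a : A) (f : V → k), ∃ g, a * Φ f = Φ g := by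
    intro a f
    have ha' : a ∈ Algebra.adjoin k (Set.range P.idem ∪ Set.range P.arrow) := by
      rw [P.generates]; trivial
    induction ha' using Algebra.adjoin_induction generalizing f with
    | mem a h =>
      rcases h with ⟨v, rfl⟩ | ⟨α, rfl⟩
      · exact ⟨_, hi v f⟩
      · exact ⟨_, ha α f⟩
    | algebraMap r => exact ⟨r • f, by simp [Algebra.algebraMap_eq_smul_one]⟩
    | add a b _ _ iha ihb =>
      obtain ⟨g, hg⟩ := iha f
      obtain ⟨g', hg'⟩ := ihb f
      exact ⟨g + g', by rw [add_mul, hg, hg', map_add]⟩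
    | mul a b _ _ iha ihb =>
      obtain ⟨g, hg⟩ := ihb f
      obtain ⟨g', hg'⟩ := iha g
      exact ⟨g', by rw [mul_assoc, hg, hg']⟩
  let r : A → Module.End k (V → k) := fun a => Ψ ∘ₗ LinearMap.mulLeft k a ∘ₗ Φ
  have hr : ∀ a f, Φ (r a f) = a * Φ f := by
    intro a f
    obtain ⟨g, hg⟩ := hstable a f
    change Φ (Ψ (a * Φ f)) = _
    rw [hg, hΨ']
  refine ⟨⟨AlgHom.ofLinearMap ⟨⟨r, ?_⟩, ?_⟩ ?_ ?_, ?_, ?_⟩⟩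
  · intro a b
    ext1 f
    apply LinearMap.ext; intro c
    apply hΦinj
    simp [hr, add_mul]
  · intro c a
    apply LinearMap.ext; intro f
    apply hΦinj
    simp [hr]
  · apply LinearMap.ext; intro f
    apply hΦinj
    change Φ (r 1 f) = _
    simp [hr]
  · intro a b
    apply LinearMap.ext; intro f
    apply hΦinj
    change Φ (r (a * b) f) = Φ (r a (r b f))
    simp [hr, mul_assoc]
  · intro v f
    apply hΦinj
    change Φ (r _ f) = _
    rw [hr, hi]
  · intro α f
    apply hΦinj
    change Φ (r _ f) = _
    rw [hr, ha]

end Thin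

namespace Thin

variable {P : QuiverPresentation k A V E}

theorem rep_apply_eq_zero_of_up (R : P.Thin) (I : P.Interval) (a : A) (f : V → k)
    (hf : ∀ v, v ∉ I.up → f v = 0) : ∀ v, v ∉ I.up → R.rep a f v = 0 := by
  have ha : a ∈ Algebra.adjoin k (Set.range P.idem ∪ Set.range P.arrow) := by
    rw [P.generates]; trivial
  induction ha using Algebra.adjoin_induction generalizing f with
  | mem a h =>
    intro v hv
    rcases h with ⟨u, rfl⟩ | ⟨α, rfl⟩
    · rw [R.rep_idem, Pi.single_apply]
      split_ifs with h
      · rw [← h, hf v hv]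
      · rfl
    · rw [R.rep_arrow, Pi.single_apply]
      split_ifs with h
      · exact hf _ fun h' => hv (h ▸ I.up_closed α h')
      · rfl
  | algebraMap r => intro v hv; simp [hf v hv]
  | add a b _ _ iha ihb => intro v hv; simp [iha f hf v hv, ihb f hf v hv]
  | mul a b _ _ iha ihb =>
    intro v hv
    rw [map_mul]
    exact iha _ (ihb f hf) v hv

theorem rep_apply_eq_zero_of_down (R : P.Thin) (I : P.Interval) (a : A) (f : V → k)
    (hf : ∀ v, v ∈ I.down → f v = 0) : ∀ v, v ∈ I.down → R.rep a f v = 0 := by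
  intro v hv
  refine R.rep_apply_eq_zero_of_up
    ⟨I.downᶜ, ∅, fun α h h' => h (I.down_closed α h'), fun α h => h.elim⟩ a f ?_ v ?_
  · intro u hu
    exact hf u (not_not.mp hu)
  · exact not_not.mpr hv

/-- Extension by zero from the vertices of an interval. -/
noncomputable def extendZero (I : P.Interval) : (I.verts → k) →ₗ[k] (V → k) where
  toFun f v := if h : v ∈ I.verts then f ⟨v, h⟩ else 0
  map_add' f g := by funext v; by_cases h : v ∈ I.verts <;> simp [h]
  map_smul' c f := by funext v; by_cases h : v ∈ I.verts <;> simp [h]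

theorem extendZero_apply (I : P.Interval) (f : I.verts → k) (v : V) :
    extendZero I f v = if h : v ∈ I.verts then f ⟨v, h⟩ else 0 := rfl

/-- The action of an element of `A` on the subquotient supported on an interval. -/
noncomputable def act (R : P.Thin) (I : P.Interval) (a : A) : Module.End k (I.verts → k) :=
  LinearMap.funLeft k k Subtype.val ∘ₗ R.rep a ∘ₗ extendZero I

theorem act_apply (R : P.Thin) (I : P.Interval) (a : A) (f : I.verts → k) (s : I.verts) :
    R.act I a f s = R.rep a (extendZero I f) s := rfl

theorem act_mul (R : P.Thin) (I : P.Interval) (a b : A) :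
    R.act I (a * b) = R.act I a * R.act I b := by
  apply LinearMap.ext; intro f
  funext s
  rw [Module.End.mul_apply, act_apply, act_apply, map_mul, Module.End.mul_apply, ← sub_eq_zero,
    ← Pi.sub_apply, ← map_sub]
  have hup : ∀ v, v ∉ I.up → R.rep b (extendZero I f) v = 0 :=
    R.rep_apply_eq_zero_of_up I b _ fun v hv => by
      rw [extendZero_apply, dif_neg fun h => hv h.1]
  refine R.rep_apply_eq_zero_of_down I a _ ?_ _ s.2.2
  intro v hv
  rw [Pi.sub_apply, extendZero_apply, sub_eq_zero]
  split_ifs with h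
  · rfl
  · exact hup v fun h' => h ⟨h', hv⟩

/-- The action on an interval as an algebra homomorphism. -/
noncomputable def actHom (R : P.Thin) (I : P.Interval) :
    A →ₐ[k] Module.End k (I.verts → k) :=
  AlgHom.ofLinearMap
    { toFun := R.act I
      map_add' := fun a b => by
        apply LinearMap.ext; intro f; funext s; simp [act_apply]
      map_smul' := fun c a => by
        apply LinearMap.ext; intro f; funext s; simp [act_apply] }
    (by
      apply LinearMap.ext; intro f; funext s
      simp [act_apply, extendZero_apply])
    (R.act_mul I)

/-- The underlying space of the interval module. -/
def IntervalSpace (_ : P.Thin) (I : P.Interval) : Type := I.verts → k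

variable (R : P.Thin) (I : P.Interval)

noncomputable instance : AddCommGroup (R.IntervalSpace I) :=
  inferInstanceAs (AddCommGroup (I.verts → k))

noncomputable instance : Module k (R.IntervalSpace I) :=
  inferInstanceAs (Module k (I.verts → k))

noncomputable instance : Module A (R.IntervalSpace I) :=
  Module.compHom (I.verts → k) (R.actHom I).toRingHom

instance : IsScalarTower k A (R.IntervalSpace I) :=
  ⟨fun c a f => by
    change R.actHom I (c • a) f = c • R.actHom I a f
    rw [map_smul]; rfl⟩

instance : Module.Finite A (R.IntervalSpace I) :=
  haveI : Module.Finite k (R.IntervalSpace I) := inferInstanceAs (Module.Finite k (I.verts → k))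
  Module.Finite.of_restrictScalars_finite k A (R.IntervalSpace I)

variable {R I}

/-- The coordinate of a vector of an interval module at a vertex. -/
noncomputable def coord (v : V) : R.IntervalSpace I →ₗ[k] k :=
  LinearMap.proj v ∘ₗ extendZero I

theorem coord_of_notMem {v : V} (hv : v ∉ I.verts) (f : R.IntervalSpace I) : coord v f = 0 :=
  dif_neg hv

theorem coord_of_mem {v : V} (hv : v ∈ I.verts) (f : R.IntervalSpace I) :
    coord v f = (show I.verts → k from f) ⟨v, hv⟩ :=
  dif_pos hv

theorem ext_coord {f g : R.IntervalSpace I} (h : ∀ v ∈ I.verts, coord v f = coord v g) :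
    f = g := by
  funext s
  have := h s s.2
  rwa [coord_of_mem s.2, coord_of_mem s.2] at this

theorem coord_smul (a : A) (f : R.IntervalSpace I) {v : V} (hv : v ∈ I.verts) :
    coord v (a • f) = R.rep a (fun u => coord u f) v := by
  change extendZero I (R.act I a f) v = _
  rw [extendZero_apply, dif_pos hv]
  rfl

theorem coord_idem_smul (u v : V) (f : R.IntervalSpace I) :
    coord v (P.idem u • f) = if v = u then coord v f else 0 := by
  by_cases hv : v ∈ I.verts
  · rw [coord_smul _ _ hv, R.rep_idem, Pi.single_apply]
    split_ifs with h
    · rw [h]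
    · rfl
  · simp [coord_of_notMem hv]

theorem coord_arrow_smul (α : E) {v : V} (hv : v ∈ I.verts) (f : R.IntervalSpace I) :
    coord v (P.arrow α • f) = if v = P.tgt α then coord (P.src α) f else 0 := by
  rw [coord_smul _ _ hv, R.rep_arrow, Pi.single_apply]

variable (R I) in
/-- The basis vector of an interval module at a vertex; zero outside of the interval. -/
noncomputable def basisVec (v : V) : R.IntervalSpace I := fun s => if (s : V) = v then 1 else 0

theorem coord_basisVec (u v : V) :
    coord u (R.basisVec I v) = if u = v ∧ u ∈ I.verts then 1 else 0 := by
  by_cases hu : u ∈ I.verts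
  · rw [coord_of_mem hu]
    simp [hu, basisVec]
  · rw [coord_of_notMem hu, if_neg fun h => hu h.2]

theorem idem_smul_basisVec (u v : V) :
    P.idem u • R.basisVec I v = if u = v then R.basisVec I v else 0 := by
  refine ext_coord fun w hw => ?_
  rw [coord_idem_smul]
  split_ifs with h1 h2 h2
  · rfl
  · rw [coord_basisVec, if_neg (by rintro ⟨rfl, _⟩; exact h2 h1.symm), map_zero]
  · rw [coord_basisVec, if_neg (by rintro ⟨rfl, _⟩; exact h1 h2.symm)]
  · rw [map_zero]

theorem arrow_smul_basisVec (α : E) (h : P.src α ∈ I.verts) :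
    P.arrow α • R.basisVec I (P.src α) = R.basisVec I (P.tgt α) := by
  refine ext_coord fun w hw => ?_
  rw [coord_arrow_smul _ hw, coord_basisVec, coord_basisVec]
  simp [h, hw]

theorem eq_sum_coord (f : R.IntervalSpace I) : f = ∑ v : V, coord v f • R.basisVec I v := by
  refine ext_coord fun w hw => ?_
  simp [map_sum, coord_basisVec, hw]

theorem basisVec_ne_zero {v : V} (hv : v ∈ I.verts) : R.basisVec I v ≠ 0 := by
  intro h
  have := coord_basisVec (R := R) (I := I) v v
  rw [h, map_zero, if_pos ⟨rfl, hv⟩] at this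
  exact zero_ne_one this

section Homs

variable {M : Type} [AddCommGroup M] [Module A M] [Module k M] [IsScalarTower k A M]

/-- A family of vectors of `M` describing a homomorphism from an interval module to `M`. -/
structure IsVecFamily (I : P.Interval) (g : V → M) : Prop where
  idem_smul : ∀ v, P.idem v • g v = g v
  eq_zero : ∀ v, v ∉ I.verts → g v = 0
  arrow_smul : ∀ α, P.src α ∈ I.verts → P.arrow α • g (P.src α) = g (P.tgt α)

/-- A family of functionals on `M` describing a homomorphism from `M` to an interval module. -/
structure IsFunctionalFamily (I : P.Interval) (φ : V → M →ₗ[k] k) : Prop where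
  idem_smul : ∀ v z, φ v (P.idem v • z) = φ v z
  eq_zero : ∀ v, v ∉ I.verts → φ v = 0
  arrow_smul : ∀ α z, P.tgt α ∈ I.verts → φ (P.tgt α) (P.arrow α • z) = φ (P.src α) z

theorem IsVecFamily.exists_hom (R : P.Thin) {g : V → M} (hg : IsVecFamily I g) :
    ∃ θ : R.IntervalSpace I →ₗ[A] M, ∀ v ∈ I.verts, θ (R.basisVec I v) = g v := by
  let θ : R.IntervalSpace I →ₗ[k] M := ∑ v : V, (coord v).smulRight (g v)
  have hθ : ∀ f, θ f = ∑ v : V, coord v f • g v := fun f => by simp [θ]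
  have hidem : ∀ u v, P.idem u • g v = if u = v then g v else 0 := by
    intro u v
    split_ifs with h
    · rw [h, hg.idem_smul]
    · rw [← hg.idem_smul v, ← mul_smul, P.idem_orth u v h, zero_smul]
  have harrow : ∀ α v, P.arrow α • g v = if v = P.src α then P.arrow α • g v else 0 := by
    intro α v
    split_ifs with h
    · rfl
    · rw [← P.arrow_mul_idem α, mul_smul, hidem, if_neg (Ne.symm h), smul_zero]
  refine ⟨{ θ with map_smul' := P.map_smul_of_generators θ ?_ ?_ }, ?_⟩
  · intro u f
    simp only [hθ, coord_idem_smul, Finset.smul_sum]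
    refine Finset.sum_congr rfl fun v _ => ?_
    rw [smul_comm, hidem]
    by_cases h : v = u
    · subst h; simp
    · simp [h, Ne.symm h]
  · intro α f
    have h1 : ∀ v, coord v (P.arrow α • f) • g v =
        if v = P.tgt α then coord (P.src α) f • g v else 0 := by
      intro v
      by_cases hv : v ∈ I.verts
      · rw [coord_arrow_smul _ hv]; split_ifs <;> simp
      · simp [hg.eq_zero v hv]
    have h2 : ∀ v, P.arrow α • coord v f • g v =
        if v = P.src α then coord v f • P.arrow α • g v else 0 := by
      intro v
      rw [smul_comm, harrow]; split_ifs <;> simp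
    simp only [hθ, Finset.smul_sum, h1, h2, Finset.sum_ite_eq', Finset.mem_univ, if_true]
    by_cases hv : P.src α ∈ I.verts
    · rw [hg.arrow_smul α hv]
    · simp [coord_of_notMem hv]
  · intro v hv
    change θ _ = _
    simp [hθ, coord_basisVec, ite_and, hv]

theorem IsFunctionalFamily.exists_hom (R : P.Thin) {φ : V → M →ₗ[k] k}
    (hφ : IsFunctionalFamily I φ) :
    ∃ θ : M →ₗ[A] R.IntervalSpace I, ∀ v z, coord v (θ z) = φ v z := by
  let θ : M →ₗ[k] R.IntervalSpace I :=
    { toFun := fun z s => φ s z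
      map_add' := fun y z => by funext s; exact map_add _ y z
      map_smul' := fun c z => by funext s; exact map_smul _ c z }
  have hθ : ∀ v z, coord v (θ z) = φ v z := by
    intro v z
    by_cases hv : v ∈ I.verts
    · exact dif_pos hv
    · rw [coord_of_notMem hv, hφ.eq_zero v hv]; rfl
  refine ⟨{ θ with map_smul' := P.map_smul_of_generators θ ?_ ?_ }, hθ⟩
  · intro u z
    refine ext_coord fun v _ => ?_
    rw [hθ, coord_idem_smul, hθ]
    split_ifs with h
    · rw [h, hφ.idem_smul]
    · rw [← hφ.idem_smul v, ← mul_smul, P.idem_orth v u h, zero_smul, map_zero]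
  · intro α z
    refine ext_coord fun v hv => ?_
    rw [hθ, coord_arrow_smul _ hv, hθ]
    split_ifs with h
    · subst h; exact hφ.arrow_smul α z hv
    · rw [← hφ.idem_smul v, ← mul_smul, ← P.idem_mul_arrow α, ← mul_assoc,
        P.idem_orth _ _ h, zero_mul, zero_smul, map_zero]

end Homs

/-- A function on the vertices of a connected interval which does not change along arrows is
constant. -/
def _root_.QuiverPresentation.Interval.IsConnected (I : P.Interval) (k : Type) : Prop :=
  ∀ lam : V → k, (∀ α, P.src α ∈ I.verts → P.tgt α ∈ I.verts → lam (P.src α) = lam (P.tgt α)) →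
    ∀ u ∈ I.verts, ∀ v ∈ I.verts, lam u = lam v

/-- Endomorphisms of the interval module of a connected interval are scalars. -/
theorem end_eq_smul (hI : I.IsConnected k) {c : V} (hc : c ∈ I.verts)
    (θ : R.IntervalSpace I →ₗ[A] R.IntervalSpace I) (f : R.IntervalSpace I) :
    θ f = coord c (θ (R.basisVec I c)) • f := by
  let lam : V → k := fun v => coord v (θ (R.basisVec I v))
  have hθ : ∀ v, θ (R.basisVec I v) = lam v • R.basisVec I v := by
    intro v
    refine ext_coord fun u hu => ?_
    rw [map_smul, coord_basisVec]
    have h := coord_idem_smul v u (θ (R.basisVec I v))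
    rw [← map_smul, idem_smul_basisVec, if_pos rfl] at h
    rw [h]
    split_ifs with h1 h2 h2
    · subst h1; simp [lam]
    · exact (h2 ⟨h1, hu⟩).elim
    · exact (h1 h2.1).elim
    · simp
  have hlam : ∀ v ∈ I.verts, lam v = lam c := by
    intro v hv
    refine hI lam ?_ v hv c hc
    intro α hs ht
    have h := map_smul θ (P.arrow α) (R.basisVec I (P.src α))
    rw [arrow_smul_basisVec α hs, hθ, hθ, smul_comm, arrow_smul_basisVec α hs] at h
    exact (smul_left_injective k (basisVec_ne_zero ht) h).symm
  have hlin : ∀ (a : k) x, θ (a • x) = a • θ x := fun a x => by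
    rw [← algebraMap_smul A a x, map_smul, algebraMap_smul]
  conv_lhs => rw [eq_sum_coord f]
  conv_rhs => rw [eq_sum_coord f]
  rw [map_sum, Finset.smul_sum]
  refine Finset.sum_congr rfl fun v _ => ?_
  rw [hlin, hθ]
  by_cases hv : v ∈ I.verts
  · rw [hlam v hv, smul_comm]
  · simp [coord_of_notMem hv]

variable (R I) in
/-- The interval module as an object of the module category. -/
noncomputable abbrev intervalModule : ModuleCat.{0} A := ModuleCat.of A (R.IntervalSpace I)

theorem finIndec_intervalModule (hI : I.IsConnected k) {c : V} (hc : c ∈ I.verts) :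
    FinIndec A (R.intervalModule I) := by
  refine ⟨inferInstanceAs (Module.Finite A (R.IntervalSpace I)),
    ⟨⟨_, 0, basisVec_ne_zero (R := R) hc⟩⟩, ?_⟩
  intro f hf
  set μ := coord c (f.hom (R.basisVec I c)) with hμ
  have hscal : ∀ x, f.hom x = μ • x := end_eq_smul hI hc f.hom
  have h1 : f.hom (f.hom (R.basisVec I c)) = f.hom (R.basisVec I c) := by
    have := congrArg (fun g => g.hom (R.basisVec I c)) hf
    simpa using this
  rw [hscal, hscal, smul_smul] at h1
  have h2 : μ * μ = μ := smul_left_injective k (basisVec_ne_zero (R := R) hc) h1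
  rcases (IsIdempotentElem.iff_eq_zero_or_one (p := μ)).mp h2 with h | h
  · left
    ext x
    simpa [h] using hscal x
  · right
    ext x
    simpa [h] using hscal x

/-- A radical morphism factors no non-zero scalar of an interval module. -/
theorem radSet_functional_eq_zero (R : P.Thin) (hI : I.IsConnected k) {c : V}
    (hc : c ∈ I.verts) {X Y : ModuleCat.{0} A}
    [Module k X] [Module k Y] [IsScalarTower k A X] [IsScalarTower k A Y]
    {f : X ⟶ Y} (hf : f ∈ radSet A X Y) {g : V → X} (hg : IsVecFamily I g)
    {φ : V → Y →ₗ[k] k} (hφ : IsFunctionalFamily I φ) : φ c (f.hom (g c)) = 0 := by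
  by_contra hne
  obtain ⟨θ, hθ⟩ := hg.exists_hom R
  obtain ⟨η, hη⟩ := hφ.exists_hom R
  refine hf (R.intervalModule I) (finIndec_intervalModule hI hc) (ModuleCat.ofHom θ)
    (ModuleCat.ofHom η) ?_
  set μ := φ c (f.hom (g c)) with hμ
  let ζ : R.IntervalSpace I →ₗ[A] R.IntervalSpace I := η ∘ₗ f.hom ∘ₗ θ
  have hζ : ∀ x, ζ x = μ • x := by
    intro x
    rw [end_eq_smul hI hc ζ x]
    congr 1
    change coord c (η (f.hom (θ _))) = _
    rw [hη, hθ c hc]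
  have hinv : Function.Bijective ζ := by
    constructor
    · intro x y hxy
      rw [hζ, hζ] at hxy
      exact smul_right_injective _ hne hxy
    · intro x
      exact ⟨μ⁻¹ • x, by rw [hζ, smul_smul, mul_inv_cancel₀ hne, one_smul]⟩
  rw [ConcreteCategory.isIso_iff_bijective]
  exact hinv

end Thin
end QuiverPresentation

section Radical

variable (A : Type) [Ring A]

/-- A morphism between indecomposable modules which is not an isomorphism is radical. -/
theorem mem_radSet_of_not_isIso {X Y : ModuleCat.{0} A} (hX : Indec A X) (hY : Indec A Y)
    {f : X ⟶ Y} (hf : ¬ IsIso f) : f ∈ radSet A X Y := by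
  intro M hM h h' hiso
  have hne : (𝟙 M : M ⟶ M) ≠ 0 := by
    intro h0
    obtain ⟨x, hx⟩ := @exists_ne _ hM.2.1 (0 : M)
    exact hx (by simpa using congrArg (fun g => g.hom x) h0)
  let e := inv (h ≫ f ≫ h')
  have he : (h ≫ f ≫ h') ≫ e = 𝟙 M := IsIso.hom_inv_id _
  have hX' : (f ≫ h' ≫ e) ≫ h = 𝟙 X := by
    refine (hX.2 ((f ≫ h' ≫ e) ≫ h) ?_).resolve_left ?_
    · simpa using congrArg (fun g => f ≫ h' ≫ e ≫ g ≫ h) he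
    · intro h0
      apply hne
      calc 𝟙 M = (h ≫ f ≫ h') ≫ e ≫ (h ≫ f ≫ h') ≫ e := by rw [he]; simpa using he.symm
        _ = h ≫ ((f ≫ h' ≫ e) ≫ h) ≫ f ≫ h' ≫ e := by simp
        _ = 0 := by rw [h0]; simp
  have hY' : (h' ≫ e ≫ h) ≫ f = 𝟙 Y := by
    refine (hY.2 ((h' ≫ e ≫ h) ≫ f) ?_).resolve_left ?_
    · simpa using congrArg (fun g => h' ≫ e ≫ g ≫ h ≫ f) he
    · intro h0
      apply hne
      calc 𝟙 M = (h ≫ f ≫ h') ≫ e ≫ (h ≫ f ≫ h') ≫ e := by rw [he]; simpa using he.symm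
        _ = h ≫ f ≫ ((h' ≫ e ≫ h) ≫ f) ≫ h' ≫ e := by simp
        _ = 0 := by rw [h0]; simp
  exact hf ⟨h' ≫ e ≫ h, by simpa using hX', hY'⟩

theorem radPowSet_succ_subset (n : ℕ) : ∀ (X Y : ModuleCat.{0} A),
    radPowSet A (n + 1) X Y ⊆ radPowSet A n X Y := by
  induction n with
  | zero => exact fun _ _ _ _ => trivial
  | succ n ih =>
    rintro X Y _ ⟨M, g, h, hM, hg, hh, rfl⟩
    exact ⟨M, g, h, hM, hg, ih _ _ hh, rfl⟩

theorem RadVanishes.mono {l m : ℕ} (hlm : l ≤ m) (h : RadVanishes A l) : RadVanishes A m := by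
  induction hlm with
  | refl => exact h
  | step _ ih => exact fun X Y hX hY f hf => ih X Y hX hY f (radPowSet_succ_subset A _ X Y hf)

end Radical

namespace QuiverPresentation.Thin

variable {k A V E : Type} [Field k] [Ring A] [Algebra k A] [Fintype V] [Fintype E]
  {P : QuiverPresentation k A V E}

theorem not_isIso_of_mem_of_notMem (R : P.Thin) {I J : P.Interval} {v : V}
    (h : ¬ (v ∈ I.verts ↔ v ∈ J.verts)) (f : R.intervalModule I ⟶ R.intervalModule J) :
    ¬ IsIso f := by
  have key : ∀ {I J : P.Interval} (f : R.intervalModule I ⟶ R.intervalModule J) [IsIso f],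
      v ∈ I.verts → v ∈ J.verts := by
    intro I J f _ hv
    by_contra hv'
    refine basisVec_ne_zero (R := R) hv ?_
    have hinj := ((ConcreteCategory.isIso_iff_bijective f).mp inferInstance).1
    apply hinj
    change f.hom _ = f.hom 0
    rw [map_zero]
    refine ext_coord (R := R) fun u hu => ?_
    have h1 : P.idem v • f.hom (R.basisVec I v) = f.hom (R.basisVec I v) := by
      rw [← map_smul, idem_smul_basisVec, if_pos rfl]
    rw [← h1, coord_idem_smul, if_neg (by rintro rfl; exact hv' hu), map_zero]
  intro hf
  exact h ⟨key f, key (inv f)⟩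

/-- The canonical morphism between two interval modules. -/
theorem exists_intervalModule_hom (R : P.Thin) {I J : P.Interval}
    (h : ∀ α, P.src α ∈ I.verts → P.tgt α ∈ J.verts → (P.src α ∈ J.verts ↔ P.tgt α ∈ I.verts)) :
    ∃ f : R.intervalModule I ⟶ R.intervalModule J,
      ∀ v ∈ I.verts, f.hom (R.basisVec I v) = R.basisVec J v := by
  have hfam : IsVecFamily I fun v => if v ∈ I.verts then R.basisVec J v else 0 := by
    refine ⟨fun v => ?_, fun v hv => if_neg hv, fun α hα => ?_⟩
    · split_ifs
      · rw [idem_smul_basisVec, if_pos rfl]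
      · rw [smul_zero]
    · rw [if_pos hα]
      refine ext_coord fun w hw => ?_
      rw [coord_arrow_smul _ hw, coord_basisVec]
      by_cases hwt : w = P.tgt α
      · subst hwt
        have := h α hα hw
        by_cases hs : P.src α ∈ J.verts
        · simp [hs, this.mp hs, coord_basisVec, hw]
        · simp [hs, mt this.mpr hs]
      · rw [if_neg hwt]
        split_ifs
        · rw [coord_basisVec, if_neg fun h => hwt h.1]
        · rw [map_zero]
  obtain ⟨θ, hθ⟩ := hfam.exists_hom R
  exact ⟨ModuleCat.ofHom θ, fun v hv => by
    change θ _ = _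
    rw [hθ v hv, if_pos hv]⟩

/-- A sequence of interval modules sharing a vertex, each mapping to the next one by a canonical
non-isomorphism, yields a non-zero composition of radical morphisms. -/
theorem not_radVanishes_of_sequence (R : P.Thin) {c : V} (L : ℕ) (J : ℕ → P.Interval)
    (hc : ∀ i ≤ L, c ∈ (J i).verts) (hconn : ∀ i ≤ L, (J i).IsConnected k)
    (hstep : ∀ i < L, ∀ α, P.src α ∈ (J i).verts → P.tgt α ∈ (J (i + 1)).verts →
      (P.src α ∈ (J (i + 1)).verts ↔ P.tgt α ∈ (J i).verts))
    (hne : ∀ i < L, ∃ v, ¬ (v ∈ (J i).verts ↔ v ∈ (J (i + 1)).verts)) :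
    ¬ RadVanishes A L := by
  have hfin : ∀ i ≤ L, FinIndec A (R.intervalModule (J i)) := fun i hi =>
    finIndec_intervalModule (hconn i hi) (hc i hi)
  have key : ∀ d i, i + d = L → ∃ f ∈ radPowSet A d (R.intervalModule (J i))
      (R.intervalModule (J L)), f.hom (R.basisVec _ c) = R.basisVec _ c := by
    intro d
    induction d with
    | zero =>
      rintro i rfl
      exact ⟨𝟙 _, trivial, rfl⟩
    | succ d ih =>
      intro i hd
      obtain ⟨f, hf, hfc⟩ := ih (i + 1) (by omega)
      have hi : i < L := by omega
      obtain ⟨g, hg⟩ := R.exists_intervalModule_hom (hstep _ hi)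
      obtain ⟨v, hv⟩ := hne _ hi
      refine ⟨g ≫ f, ⟨_, g, f, (hfin _ hi).1, ?_, hf, rfl⟩, ?_⟩
      · exact mem_radSet_of_not_isIso A (hfin _ hi.le).2 (hfin _ hi).2
          (R.not_isIso_of_mem_of_notMem hv g)
      · change f.hom (g.hom _) = _
        rw [hg _ (hc _ hi.le), hfc]
  intro hvan
  obtain ⟨f, hf, hfc⟩ := key L 0 (zero_add L)
  have h0 := hvan _ _ (hfin _ L.zero_le).1 (hfin _ le_rfl).1 f hf
  rw [h0] at hfc
  exact basisVec_ne_zero (R := R) (hc L le_rfl) hfc.symm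

end QuiverPresentation.Thin

section ChainPath

variable {A : Type} [Ring A]

/-- The product of `d` consecutive elements of `a`, starting with the idempotent `e i`. -/
def chainProd (e a : ℕ → A) (i : ℕ) : ℕ → A
  | 0 => e i
  | d + 1 => a (i + d) * chainProd e a i d

/-- The product of the elements `a i, …, a (j - 1)`, written right to left. -/
def chainPath (e a : ℕ → A) (i j : ℕ) : A := chainProd e a i (j - i)

theorem chainPath_self (e a : ℕ → A) (i : ℕ) : chainPath e a i i = e i := by
  simp [chainPath, chainProd]

theorem chainPath_succ (e a : ℕ → A) {i j : ℕ} (h : i ≤ j) :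
    chainPath e a i (j + 1) = a j * chainPath e a i j := by
  rw [chainPath, Nat.succ_sub h, chainProd, chainPath, Nat.add_sub_cancel' h]

variable {e a : ℕ → A}

theorem chainPath_mul_idem (he : ∀ t, e t * e t = e t) {i j : ℕ} (h : i ≤ j) :
    chainPath e a i j * e i = chainPath e a i j := by
  induction j, h using Nat.le_induction with
  | base => rw [chainPath_self, he]
  | succ j h ih => rw [chainPath_succ e a h, mul_assoc, ih]

theorem idem_mul_chainPath (he : ∀ t, e t * e t = e t) (ht : ∀ t, e (t + 1) * a t = a t)
    {i j : ℕ} (h : i ≤ j) : e j * chainPath e a i j = chainPath e a i j := by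
  induction j, h using Nat.le_induction with
  | base => rw [chainPath_self, he]
  | succ j h ih => rw [chainPath_succ e a h, ← mul_assoc, ht]

theorem chainPath_mul_chainPath (he : ∀ t, e t * e t = e t) (ht : ∀ t, e (t + 1) * a t = a t)
    {i j l : ℕ} (hij : i ≤ j) (hjl : j ≤ l) :
    chainPath e a j l * chainPath e a i j = chainPath e a i l := by
  induction l, hjl using Nat.le_induction with
  | base => rw [chainPath_self, idem_mul_chainPath he ht hij]
  | succ l h ih => rw [chainPath_succ e a h, mul_assoc, ih, ← chainPath_succ e a (hij.trans h)]

theorem chainPath_mul_step (hs : ∀ t, a t * e t = a t) {i j : ℕ} (he : ∀ t, e t * e t = e t)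
    (ht : ∀ t, e (t + 1) * a t = a t) (h : i + 1 ≤ j) :
    chainPath e a (i + 1) j * a i = chainPath e a i j := by
  rw [← chainPath_mul_chainPath he ht (Nat.le_succ i) h, chainPath_succ e a le_rfl,
    chainPath_self, hs]

end ChainPath

namespace QuiverPresentation

variable {k A V E : Type} [Field k] [Ring A] [Algebra k A] [Fintype V] [Fintype E]

/-- The products along the subpaths of a branch with vertices `x 0, …, x (n + 1)`; paths which
continue after the last vertex are zero. -/
noncomputable def branchPath (P : QuiverPresentation k A V E) (x : ℕ → V) (ax : ℕ → E) (n : ℕ) :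
    ℕ → ℕ → A :=
  chainPath (fun t => P.idem (x t)) (fun t => if t ≤ n then P.arrow (ax t) else 0)

/-- A quiver consisting of two parallel branches with `n` and `m` intermediate vertices, the two
branches having the same non-zero product. -/
structure TwoBranches (P : QuiverPresentation k A V E) (n m : ℕ) where
  x : ℕ → V
  y : ℕ → V
  ax : ℕ → E
  ay : ℕ → E
  start : x 0 = y 0
  finish : x (n + 1) = y (m + 1)
  x_inj : ∀ s t, s ≤ n + 1 → t ≤ n + 1 → x s = x t → s = t
  y_inj : ∀ s t, s ≤ m + 1 → t ≤ m + 1 → y s = y t → s = t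
  x_eq_y : ∀ s t, s ≤ n + 1 → t ≤ m + 1 → x s = y t → s = 0 ∧ t = 0 ∨ s = n + 1 ∧ t = m + 1
  vertex_cases : ∀ v, (∃ t ≤ n + 1, x t = v) ∨ ∃ t ≤ m + 1, y t = v
  arrow_cases : ∀ α, (∃ t ≤ n, ax t = α) ∨ ∃ t ≤ m, ay t = α
  src_ax : ∀ t ≤ n, P.src (ax t) = x t
  tgt_ax : ∀ t ≤ n, P.tgt (ax t) = x (t + 1)
  src_ay : ∀ t ≤ m, P.src (ay t) = y t
  tgt_ay : ∀ t ≤ m, P.tgt (ay t) = y (t + 1)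
  comm : P.branchPath x ax n 0 (n + 1) = P.branchPath y ay m 0 (m + 1)
  ne_zero : P.branchPath x ax n 0 (n + 1) ≠ 0

section BranchPath

variable {P : QuiverPresentation k A V E} {x : ℕ → V} {ax : ℕ → E} {n : ℕ}

theorem branchPath_self (i : ℕ) : P.branchPath x ax n i i = P.idem (x i) := chainPath_self _ _ _

theorem branchPath_succ {i j : ℕ} (hij : i ≤ j) (hj : j ≤ n) :
    P.branchPath x ax n i (j + 1) = P.arrow (ax j) * P.branchPath x ax n i j := by
  rw [branchPath, chainPath_succ _ _ hij, if_pos hj]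

theorem branchPath_eq_zero {i : ℕ} (hi : i ≤ n + 1) : P.branchPath x ax n i (n + 2) = 0 := by
  rw [branchPath, chainPath_succ _ _ hi, if_neg (by omega), zero_mul]

theorem branchPath_mul_idem {i j : ℕ} (h : i ≤ j) :
    P.branchPath x ax n i j * P.idem (x i) = P.branchPath x ax n i j :=
  chainPath_mul_idem (e := fun t => P.idem (x t)) (fun _ => P.idem_idem _) h

theorem idem_mul_truncatedArrow (htgt : ∀ t ≤ n, P.tgt (ax t) = x (t + 1)) (t : ℕ) :
    P.idem (x (t + 1)) * (if t ≤ n then P.arrow (ax t) else 0) =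
      if t ≤ n then P.arrow (ax t) else 0 := by
  split_ifs with h
  · rw [← htgt t h, P.idem_mul_arrow]
  · rw [mul_zero]

theorem idem_mul_branchPath (htgt : ∀ t ≤ n, P.tgt (ax t) = x (t + 1)) {i j : ℕ} (h : i ≤ j) :
    P.idem (x j) * P.branchPath x ax n i j = P.branchPath x ax n i j :=
  idem_mul_chainPath (e := fun t => P.idem (x t)) (fun _ => P.idem_idem _)
    (idem_mul_truncatedArrow htgt) h

theorem branchPath_mul_branchPath (htgt : ∀ t ≤ n, P.tgt (ax t) = x (t + 1))
    {i j l : ℕ} (hij : i ≤ j) (hjl : j ≤ l) :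
    P.branchPath x ax n j l * P.branchPath x ax n i j = P.branchPath x ax n i l :=
  chainPath_mul_chainPath (e := fun t => P.idem (x t)) (fun _ => P.idem_idem _)
    (idem_mul_truncatedArrow htgt) hij hjl

theorem branchPath_mul_arrow (htgt : ∀ t ≤ n, P.tgt (ax t) = x (t + 1))
    (hsrc : ∀ t ≤ n, P.src (ax t) = x t) {i j : ℕ} (h : i + 1 ≤ j)
    (hi : i ≤ n) : P.branchPath x ax n (i + 1) j * P.arrow (ax i) = P.branchPath x ax n i j := by
  have := chainPath_mul_step (e := fun t => P.idem (x t))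
    (a := fun t => if t ≤ n then P.arrow (ax t) else 0)
    (fun t => by
      split_ifs with h
      · rw [← hsrc t h, P.arrow_mul_idem]
      · rw [zero_mul])
    (fun _ => P.idem_idem _) (idem_mul_truncatedArrow htgt) h
  rwa [if_pos hi] at this

end BranchPath

namespace TwoBranches

variable {P : QuiverPresentation k A V E} {n m : ℕ} (B : P.TwoBranches n m)

/-- Exchange the roles of the two branches. -/
def swap : P.TwoBranches m n where
  x := B.y
  y := B.x
  ax := B.ay
  ay := B.ax
  start := B.start.symm
  finish := B.finish.symm
  x_inj := B.y_inj
  y_inj := B.x_inj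
  x_eq_y s t hs ht h := (B.x_eq_y t s ht hs h.symm).imp And.symm And.symm
  vertex_cases v := (B.vertex_cases v).symm
  arrow_cases α := (B.arrow_cases α).symm
  src_ax := B.src_ay
  tgt_ax := B.tgt_ay
  src_ay := B.src_ax
  tgt_ay := B.tgt_ax
  comm := B.comm.symm
  ne_zero := B.comm ▸ B.ne_zero

/-- The products along the subpaths of the first branch. -/
noncomputable def X (i j : ℕ) : A := P.branchPath B.x B.ax n i j

/-- The products along the subpaths of the second branch. -/
noncomputable def Y (i j : ℕ) : A := P.branchPath B.y B.ay m i j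

/-- Families along the two branches which agree at the common ends glue to a family indexed by the
vertices. -/
theorem exists_glue {T : Type} (fx fy : ℕ → T) (h0 : fx 0 = fy 0)
    (h1 : fx (n + 1) = fy (m + 1)) :
    ∃ F : V → T, (∀ t ≤ n + 1, F (B.x t) = fx t) ∧ ∀ t ≤ m + 1, F (B.y t) = fy t := by
  have key : ∀ v, ∃ z : T, (∀ t ≤ n + 1, B.x t = v → z = fx t) ∧
      ∀ t ≤ m + 1, B.y t = v → z = fy t := by
    intro v
    rcases B.vertex_cases v with ⟨s, hs, rfl⟩ | ⟨s, hs, rfl⟩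
    · refine ⟨fx s, fun t ht h => by rw [B.x_inj t s ht hs h], fun t ht h => ?_⟩
      rcases B.x_eq_y s t hs ht h.symm with ⟨rfl, rfl⟩ | ⟨rfl, rfl⟩
      · exact h0
      · exact h1
    · refine ⟨fy s, fun t ht h => ?_, fun t ht h => by rw [B.y_inj t s ht hs h]⟩
      rcases B.x_eq_y t s ht hs h with ⟨rfl, rfl⟩ | ⟨rfl, rfl⟩
      · exact h0.symm
      · exact h1.symm
  choose F hx hy using key
  exact ⟨F, fun t ht => hx _ t ht rfl, fun t ht => hy _ t ht rfl⟩

theorem nonempty_thin (B : P.TwoBranches n m) : Nonempty P.Thin := by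
  obtain ⟨w, hx, hy⟩ := B.exists_glue (B.X 0) (B.Y 0)
    (by rw [X, Y, branchPath_self, branchPath_self, B.start]) B.comm
  have hYne : B.Y 0 (m + 1) ≠ 0 := B.swap.ne_zero
  refine Thin.nonempty_of_elements w (fun v => ?_) (fun v => ?_) (fun α => ?_)
  · rcases B.vertex_cases v with ⟨t, ht, rfl⟩ | ⟨t, ht, rfl⟩
    · rw [hx t ht]
      intro h
      apply B.ne_zero
      rw [← branchPath_mul_branchPath B.tgt_ax t.zero_le ht]
      change _ * B.X 0 t = 0
      rw [h, mul_zero]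
    · rw [hy t ht]
      intro h
      apply hYne
      rw [Y, ← branchPath_mul_branchPath B.tgt_ay t.zero_le ht]
      change _ * B.Y 0 t = 0
      rw [h, mul_zero]
  · rcases B.vertex_cases v with ⟨t, ht, rfl⟩ | ⟨t, ht, rfl⟩
    · rw [hx t ht, X, idem_mul_branchPath B.tgt_ax t.zero_le]
    · rw [hy t ht, Y, idem_mul_branchPath B.tgt_ay t.zero_le]
  · rcases B.arrow_cases α with ⟨t, ht, rfl⟩ | ⟨t, ht, rfl⟩
    · rw [B.src_ax t ht, B.tgt_ax t ht, hx t (by omega), hx (t + 1) (by omega), X, X,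
        branchPath_succ t.zero_le ht]
    · rw [B.src_ay t ht, B.tgt_ay t ht, hy t (by omega), hy (t + 1) (by omega), Y, Y,
        branchPath_succ t.zero_le ht]

end TwoBranches

/-- The data of a connected convex set of vertices containing the vertex `y j`: it meets the two
branches in the vertices `y p, …, y q` and `x r, …, x s`. -/
structure Window (n m j : ℕ) where
  p : ℕ
  q : ℕ
  r : ℕ
  s : ℕ
  p_le : p ≤ j
  le_q : j ≤ q
  q_le : q ≤ m + 1
  r_le : r ≤ n + 1
  s_le : s ≤ n + 1
  start_iff : p = 0 ↔ r = 0
  finish_iff : q = m + 1 ↔ s = n + 1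
  connected : r ≤ s → r = 0 ∨ s = n + 1

namespace Window

variable {n m j : ℕ} (w : Window n m j)

/-- The position of a window, counted from the one of the projective module at `y j`. -/
def level : ℕ :=
  (if w.p = 0 then j + n + 1 - w.s else j + 1 - w.p) +
    (if w.q = m + 1 then n + 1 - w.r else n + 1 + m - w.q)

theorem level_le : w.level ≤ 2 * n + m + 2 := by
  have := w.p_le
  have := w.le_q
  have := w.q_le
  have := w.finish_iff
  have := w.start_iff
  unfold level
  split_ifs <;> omega

end Window

namespace TwoBranches

variable {P : QuiverPresentation k A V E} {n m j : ℕ} (B : P.TwoBranches n m)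

/-- The interval of vertices described by a window. -/
def interval (w : Window n m j) : P.Interval where
  up := {v | (∃ t ≤ n + 1, B.x t = v ∧ w.r ≤ t) ∨ ∃ t ≤ m + 1, B.y t = v ∧ w.p ≤ t}
  down := {v | (∃ t ≤ n + 1, B.x t = v ∧ t ≤ w.s) ∨ ∃ t ≤ m + 1, B.y t = v ∧ t ≤ w.q}
  up_closed α h := by
    have hw := w.start_iff
    rcases B.arrow_cases α with ⟨i, hi, rfl⟩ | ⟨i, hi, rfl⟩
    · rw [B.src_ax i hi] at h
      rw [B.tgt_ax i hi]
      refine Or.inl ⟨i + 1, by omega, rfl, ?_⟩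
      rcases h with ⟨t, ht, hti, h⟩ | ⟨t, ht, hti, h⟩
      · have := B.x_inj t i ht (by omega) hti
        omega
      · have := B.x_eq_y i t (by omega) ht hti.symm
        omega
    · rw [B.src_ay i hi] at h
      rw [B.tgt_ay i hi]
      refine Or.inr ⟨i + 1, by omega, rfl, ?_⟩
      rcases h with ⟨t, ht, hti, h⟩ | ⟨t, ht, hti, h⟩
      · have := B.x_eq_y t i ht (by omega) hti
        omega
      · have := B.y_inj t i ht (by omega) hti
        omega
  down_closed α h := by
    have hw := w.finish_iff
    have hq := w.q_le
    have hs := w.s_le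
    rcases B.arrow_cases α with ⟨i, hi, rfl⟩ | ⟨i, hi, rfl⟩
    · rw [B.tgt_ax i hi] at h
      rw [B.src_ax i hi]
      refine Or.inl ⟨i, by omega, rfl, ?_⟩
      rcases h with ⟨t, ht, hti, h⟩ | ⟨t, ht, hti, h⟩
      · have := B.x_inj t (i + 1) ht (by omega) hti
        omega
      · have := B.x_eq_y (i + 1) t (by omega) ht hti.symm
        omega
    · rw [B.tgt_ay i hi] at h
      rw [B.src_ay i hi]
      refine Or.inr ⟨i, by omega, rfl, ?_⟩
      rcases h with ⟨t, ht, hti, h⟩ | ⟨t, ht, hti, h⟩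
      · have := B.x_eq_y t (i + 1) ht (by omega) hti
        omega
      · have := B.y_inj t (i + 1) ht (by omega) hti
        omega

variable {B}

theorem x_mem_interval {w : Window n m j} {t : ℕ} (ht : t ≤ n + 1) :
    B.x t ∈ (B.interval w).verts ↔ w.r ≤ t ∧ t ≤ w.s := by
  have h1 := w.start_iff
  have h2 := w.finish_iff
  have := w.q_le
  have := w.p_le
  have := w.le_q
  have := w.r_le
  have := w.s_le
  constructor
  · rintro ⟨⟨u, hu, hut, h⟩ | ⟨u, hu, hut, h⟩, ⟨u', hu', hut', h'⟩ | ⟨u', hu', hut', h'⟩⟩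
    · have := B.x_inj u t hu ht hut
      have := B.x_inj u' t hu' ht hut'
      omega
    · have := B.x_inj u t hu ht hut
      have := B.x_eq_y t u' ht hu' hut'.symm
      omega
    · have := B.x_eq_y t u ht hu hut.symm
      have := B.x_inj u' t hu' ht hut'
      omega
    · have := B.x_eq_y t u ht hu hut.symm
      have := B.x_eq_y t u' ht hu' hut'.symm
      omega
  · rintro ⟨h, h'⟩
    exact ⟨Or.inl ⟨t, ht, rfl, h⟩, Or.inl ⟨t, ht, rfl, h'⟩⟩

theorem y_mem_interval {w : Window n m j} {t : ℕ} (ht : t ≤ m + 1) :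
    B.y t ∈ (B.interval w).verts ↔ w.p ≤ t ∧ t ≤ w.q := by
  have h1 := w.start_iff
  have h2 := w.finish_iff
  have := w.q_le
  have := w.p_le
  have := w.le_q
  have := w.r_le
  have := w.s_le
  constructor
  · rintro ⟨⟨u, hu, hut, h⟩ | ⟨u, hu, hut, h⟩, ⟨u', hu', hut', h'⟩ | ⟨u', hu', hut', h'⟩⟩
    · have := B.x_eq_y u t hu ht hut
      have := B.x_eq_y u' t hu' ht hut'
      omega
    · have := B.x_eq_y u t hu ht hut
      have := B.y_inj u' t hu' ht hut'
      omega
    · have := B.y_inj u t hu ht hut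
      have := B.x_eq_y u' t hu' ht hut'
      omega
    · have := B.y_inj u t hu ht hut
      have := B.y_inj u' t hu' ht hut'
      omega
  · rintro ⟨h, h'⟩
    exact ⟨Or.inr ⟨t, ht, rfl, h⟩, Or.inr ⟨t, ht, rfl, h'⟩⟩

theorem base_mem_interval (w : Window n m j) : B.y j ∈ (B.interval w).verts :=
  (y_mem_interval (w.le_q.trans w.q_le)).mpr ⟨w.p_le, w.le_q⟩

theorem eq_of_forall_succ_eq {T : Type} {f : ℕ → T} {a b : ℕ}
    (h : ∀ t, a ≤ t → t + 1 ≤ b → f t = f (t + 1)) {s t : ℕ} (has : a ≤ s) (hst : s ≤ t)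
    (htb : t ≤ b) : f s = f t := by
  induction t, hst using Nat.le_induction with
  | base => rfl
  | succ t hst ih => rw [ih (by omega), h t (by omega) htb]

theorem isConnected_interval (w : Window n m j) : (B.interval w).IsConnected k := by
  intro lam hlam
  have := w.q_le
  have := w.r_le
  have := w.s_le
  have := w.p_le
  have := w.le_q
  have hst := w.start_iff
  have hfi := w.finish_iff
  have hy : ∀ t, w.p ≤ t → t + 1 ≤ w.q → lam (B.y t) = lam (B.y (t + 1)) := by
    intro t h1 h2
    have := hlam (B.ay t)
    rw [B.src_ay t (by omega), B.tgt_ay t (by omega), y_mem_interval (by omega),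
      y_mem_interval (by omega)] at this
    exact this (by omega) (by omega)
  have hx : ∀ t, w.r ≤ t → t + 1 ≤ w.s → lam (B.x t) = lam (B.x (t + 1)) := by
    intro t h1 h2
    have := hlam (B.ax t)
    rw [B.src_ax t (by omega), B.tgt_ax t (by omega), x_mem_interval (by omega),
      x_mem_interval (by omega)] at this
    exact this (by omega) (by omega)
  have key : ∀ v ∈ (B.interval w).verts, lam v = lam (B.y j) := by
    intro v hv
    have hyj : ∀ t, w.p ≤ t → t ≤ w.q → lam (B.y t) = lam (B.y j) := by
      intro t h1 h2
      rcases le_total t j with h | h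
      · exact eq_of_forall_succ_eq (f := fun t => lam (B.y t)) hy h1 h w.le_q
      · exact (eq_of_forall_succ_eq (f := fun t => lam (B.y t)) hy w.p_le h h2).symm
    rcases B.vertex_cases v with ⟨t, ht, rfl⟩ | ⟨t, ht, rfl⟩
    · obtain ⟨h1, h2⟩ := (x_mem_interval ht).mp hv
      rcases w.connected (h1.trans h2) with h | h
      · rw [← eq_of_forall_succ_eq (f := fun t => lam (B.x t)) hx (s := 0) (by omega)
          t.zero_le h2, B.start]
        exact hyj 0 (by omega) (by omega)
      · rw [eq_of_forall_succ_eq (f := fun t => lam (B.x t)) hx (t := n + 1) h1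
          (by omega) (by omega), B.finish]
        exact hyj (m + 1) (by omega) (by omega)
    · obtain ⟨h1, h2⟩ := (y_mem_interval ht).mp hv
      exact hyj t h1 h2
  intro u hu v hv
  rw [key u hu, key v hv]

/-- The lower bound: a chain of interval modules leading from the projective module at `y 1` to the
injective module at `y 1`. -/
theorem not_radVanishes (B : P.TwoBranches n m) (hm : 1 ≤ m) :
    ¬ RadVanishes A (2 * n + m + 1) := by
  obtain ⟨R⟩ := B.nonempty_thin
  let w : ℕ → Window n m 1 := fun i =>
    { p := if i ≤ n then 1 else 0
      q := if i ≤ n + 1 then m + 1 else max 1 (min m (2 * n + 2 + m - i))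
      r := n + 1 - i
      s := if i ≤ n + 1 then n + 1 else 2 * n + 2 - i
      p_le := by split_ifs <;> omega
      le_q := by split_ifs <;> omega
      q_le := by split_ifs <;> omega
      r_le := by omega
      s_le := by split_ifs <;> omega
      start_iff := by split_ifs <;> simp <;> omega
      finish_iff := by split_ifs <;> omega
      connected := by split_ifs <;> omega }
  refine R.not_radVanishes_of_sequence (c := B.y 1) _ (fun i => B.interval (w i))
    (fun i _ => base_mem_interval _) (fun i _ => isConnected_interval _) ?_ ?_
  · intro i hi α
    rcases B.arrow_cases α with ⟨t, ht, rfl⟩ | ⟨t, ht, rfl⟩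
    · rw [B.src_ax t ht, B.tgt_ax t ht]
      iterate 4 rw [x_mem_interval (by omega)]
      simp only [w]
      split_ifs <;> omega
    · rw [B.src_ay t ht, B.tgt_ay t ht]
      iterate 4 rw [y_mem_interval (by omega)]
      simp only [w]
      split_ifs <;> omega
  · intro i hi
    by_cases h1 : i ≤ n
    · refine ⟨B.x (n - i), ?_⟩
      rw [x_mem_interval (by omega), x_mem_interval (by omega)]
      simp only [w]
      split_ifs <;> omega
    by_cases h2 : i ≤ 2 * n + 1
    · refine ⟨B.x (2 * n + 2 - i), ?_⟩
      rw [x_mem_interval (by omega), x_mem_interval (by omega)]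
      simp only [w]
      split_ifs <;> omega
    · refine ⟨B.y (2 * n + 2 + m - i), ?_⟩
      rw [y_mem_interval (by omega), y_mem_interval (by omega)]
      simp only [w]
      split_ifs <;> omega

end TwoBranches

theorem exists_functional_comp_eq {M N : Type} [AddCommGroup M] [Module k M] [AddCommGroup N]
    [Module k N] (f : M →ₗ[k] N) (R : Submodule k N) {φ : M →ₗ[k] k}
    (hφ : R.comap f ≤ LinearMap.ker φ) :
    ∃ ψ : N →ₗ[k] k, R ≤ LinearMap.ker ψ ∧ ∀ z, ψ (f z) = φ z := by
  have h : φ ∈ LinearMap.range (R.mkQ ∘ₗ f).dualMap := by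
    rw [LinearMap.range_dualMap_eq_dualAnnihilator_ker, Submodule.mem_dualAnnihilator]
    intro z hz
    refine hφ ?_
    simpa using hz
  obtain ⟨ψ, hψ⟩ := h
  refine ⟨ψ ∘ₗ R.mkQ, fun z hz => ?_, fun z => ?_⟩
  · simp [(Submodule.Quotient.mk_eq_zero R).mpr hz]
  · rw [← hψ]; rfl

namespace TwoBranches

variable {P : QuiverPresentation k A V E} {n m : ℕ} (B : P.TwoBranches n m)
variable {M : Type} [AddCommGroup M] [Module A M]

section Paths

theorem X_smul_X {i j l : ℕ} (hij : i ≤ j) (hjl : j ≤ l) (z : M) :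
    B.X j l • B.X i j • z = B.X i l • z := by
  rw [← mul_smul, X, X, branchPath_mul_branchPath B.tgt_ax hij hjl, X]

theorem Y_smul_Y {i j l : ℕ} (hij : i ≤ j) (hjl : j ≤ l) (z : M) :
    B.Y j l • B.Y i j • z = B.Y i l • z :=
  B.swap.X_smul_X hij hjl z

theorem X_zero_zero : B.X 0 0 = B.Y 0 0 := by
  rw [X, Y, branchPath_self, branchPath_self, B.start]

theorem X_zero_last : B.X 0 (n + 1) = B.Y 0 (m + 1) := B.comm

theorem X_last_last : B.X (n + 1) (n + 1) = B.Y (m + 1) (m + 1) := by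
  rw [X, Y, branchPath_self, branchPath_self, B.finish]

theorem X_eq_zero {i : ℕ} (hi : i ≤ n + 1) : B.X i (n + 2) = 0 := branchPath_eq_zero hi

theorem Y_eq_zero {i : ℕ} (hi : i ≤ m + 1) : B.Y i (m + 2) = 0 := branchPath_eq_zero hi

theorem idem_smul_X {i j : ℕ} (h : i ≤ j) (z : M) :
    P.idem (B.x j) • B.X i j • z = B.X i j • z := by
  rw [← mul_smul, X, idem_mul_branchPath B.tgt_ax h]

theorem idem_smul_Y {i j : ℕ} (h : i ≤ j) (z : M) :
    P.idem (B.y j) • B.Y i j • z = B.Y i j • z :=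
  B.swap.idem_smul_X h z

theorem X_smul_idem {i j : ℕ} (h : i ≤ j) (z : M) :
    B.X i j • P.idem (B.x i) • z = B.X i j • z := by
  rw [← mul_smul, X, branchPath_mul_idem h]

theorem Y_smul_idem {i j : ℕ} (h : i ≤ j) (z : M) :
    B.Y i j • P.idem (B.y i) • z = B.Y i j • z :=
  B.swap.X_smul_idem h z

theorem arrow_smul_X {i j : ℕ} (h : i ≤ j) (hj : j ≤ n) (z : M) :
    P.arrow (B.ax j) • B.X i j • z = B.X i (j + 1) • z := by
  rw [← mul_smul, X, X, branchPath_succ h hj]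

theorem arrow_smul_Y {i j : ℕ} (h : i ≤ j) (hj : j ≤ m) (z : M) :
    P.arrow (B.ay j) • B.Y i j • z = B.Y i (j + 1) • z :=
  B.swap.arrow_smul_X h hj z

theorem X_smul_arrow {i j : ℕ} (h : i + 1 ≤ j) (hi : i ≤ n) (z : M) :
    B.X (i + 1) j • P.arrow (B.ax i) • z = B.X i j • z := by
  rw [← mul_smul, X, branchPath_mul_arrow B.tgt_ax B.src_ax h hi, X]

theorem Y_smul_arrow {i j : ℕ} (h : i + 1 ≤ j) (hi : i ≤ m) (z : M) :
    B.Y (i + 1) j • P.arrow (B.ay i) • z = B.Y i j • z :=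
  B.swap.X_smul_arrow h hi z

theorem eq_zero_of_Y_self_smul {p j : ℕ} (hp : p ≤ j) {z : M}
    (h : B.Y j j • B.Y p j • z = 0) : B.Y p j • z = 0 := by
  rwa [B.Y_smul_Y hp le_rfl] at h

end Paths

variable [Module k M] [IsScalarTower k A M] {j : ℕ}

variable (k M) in
/-- The elements at `y j` which come from `y p`, and, for `p = 0`, from an element annihilated by
the path from `x 0` to `x (s + 1)`. -/
noncomputable def lower (j p s : ℕ) : Submodule k M :=
  (if p = 0 then LinearMap.ker (Algebra.lsmul k k M (B.X 0 (s + 1))) else ⊤).map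
    (Algebra.lsmul k k M (B.Y p j))

variable (k M) in
/-- The elements at `y j` which are annihilated by the path to `y (q + 1)` and, for `q = m + 1`,
are sent to the image of the path from `x r` to the sink. -/
noncomputable def upper (j q r : ℕ) : Submodule k M :=
  LinearMap.ker (Algebra.lsmul k k M (B.Y j (q + 1))) ⊓
    if q = m + 1 then (LinearMap.range (Algebra.lsmul k k M (B.X r (n + 1)))).comap
      (Algebra.lsmul k k M (B.Y j (m + 1))) else ⊤

variable (k M) in
/-- The next smaller member of the chain of the submodules `lower`. -/
noncomputable def lowerRad (j p s : ℕ) : Submodule k M :=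
  if p = 0 then (LinearMap.ker (Algebra.lsmul k k M (B.X 0 s))).map (Algebra.lsmul k k M (B.Y 0 j))
  else LinearMap.range (Algebra.lsmul k k M (B.Y (p - 1) j))

variable (k M) in
/-- The next smaller member of the chain of the submodules `upper`. -/
noncomputable def upperRad (j q r : ℕ) : Submodule k M :=
  (if q = m + 1 ∧ 1 ≤ r then LinearMap.range (Algebra.lsmul k k M (B.X (r - 1) (n + 1)))
    else ⊥).comap (Algebra.lsmul k k M (B.Y j q))

theorem mem_lower {p s : ℕ} {a : M} :
    a ∈ B.lower k M j p s ↔ ∃ z : M, B.Y p j • z = a ∧ (p = 0 → B.X 0 (s + 1) • z = 0) := by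
  unfold lower
  split_ifs with h <;> simp [h, and_comm]

theorem mem_upper {q r : ℕ} {a : M} :
    a ∈ B.upper k M j q r ↔ B.Y j (q + 1) • a = 0 ∧
      (q = m + 1 → ∃ z : M, B.X r (n + 1) • z = B.Y j (m + 1) • a) := by
  unfold upper
  split_ifs with h <;> simp [h]

theorem mem_lowerRad_zero {s : ℕ} {a : M} :
    a ∈ B.lowerRad k M j 0 s ↔ ∃ z : M, B.X 0 s • z = 0 ∧ B.Y 0 j • z = a := by
  simp [lowerRad]

theorem mem_lowerRad_succ {p s : ℕ} {a : M} :
    a ∈ B.lowerRad k M j (p + 1) s ↔ ∃ z : M, B.Y p j • z = a := by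
  simp [lowerRad]

theorem mem_upperRad_of_pos {r : ℕ} (hr : 1 ≤ r) {a : M} :
    a ∈ B.upperRad k M j (m + 1) r ↔
      ∃ z : M, B.X (r - 1) (n + 1) • z = B.Y j (m + 1) • a := by
  simp [upperRad, hr]

theorem mem_upperRad_of_not {q r : ℕ} (h : ¬ (q = m + 1 ∧ 1 ≤ r)) {a : M} :
    a ∈ B.upperRad k M j q r ↔ B.Y j q • a = 0 := by
  simp [upperRad, h]

variable (k) in
theorem exists_isVecFamily (w : Window n m j) {a : M} (ha : a ∈ B.lower k M j w.p w.s)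
    (ha' : a ∈ B.upper k M j w.q w.r) :
    ∃ g : V → M, Thin.IsVecFamily (B.interval w) g ∧ g (B.y j) = a := by
  have := w.p_le
  have := w.le_q
  have := w.q_le
  have := w.r_le
  have := w.s_le
  have hst := w.start_iff
  have hfi := w.finish_iff
  obtain ⟨z, rfl, hz⟩ := B.mem_lower.mp ha
  obtain ⟨hq, hq'⟩ := B.mem_upper.mp ha'
  rw [B.Y_smul_Y (by omega) (by omega)] at hq hq'
  obtain ⟨z', hz0, hz1⟩ : ∃ z' : M, (w.r = 0 → z' = z) ∧
      (w.q = m + 1 → B.X w.r (n + 1) • z' = B.Y w.p (m + 1) • z) := by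
    by_cases hr : w.r = 0
    · refine ⟨z, fun _ => rfl, fun _ => ?_⟩
      rw [hr, hst.mpr hr, X_zero_last]
    by_cases hqm : w.q = m + 1
    · obtain ⟨z', h⟩ := hq' hqm
      exact ⟨z', fun h => (hr h).elim, fun _ => h⟩
    · exact ⟨0, fun h => (hr h).elim, fun h => (hqm h).elim⟩
  obtain ⟨g, hx, hy⟩ := B.exists_glue
    (fun t => if w.r ≤ t ∧ t ≤ w.s then B.X w.r t • z' else 0)
    (fun t => if w.p ≤ t ∧ t ≤ w.q then B.Y w.p t • z else 0) (by
      by_cases hp : w.p = 0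
      · rw [if_pos (by omega), if_pos (by omega), hz0 (hst.mp hp), hp, hst.mp hp, X_zero_zero]
      · rw [if_neg (by omega), if_neg (by omega)]) (by
      by_cases hq : w.q = m + 1
      · rw [if_pos (by omega), if_pos (by omega), hz1 hq]
      · rw [if_neg (by omega), if_neg (by omega)])
  refine ⟨g, ⟨fun v => ?_, fun v hv => ?_, fun α hα => ?_⟩, ?_⟩
  · rcases B.vertex_cases v with ⟨t, ht, rfl⟩ | ⟨t, ht, rfl⟩
    · rw [hx t ht]
      split_ifs with h
      · exact B.idem_smul_X h.1 _
      · exact smul_zero _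
    · rw [hy t ht]
      split_ifs with h
      · exact B.idem_smul_Y h.1 _
      · exact smul_zero _
  · rcases B.vertex_cases v with ⟨t, ht, rfl⟩ | ⟨t, ht, rfl⟩
    · rw [x_mem_interval ht] at hv
      rw [hx t ht, if_neg hv]
    · rw [y_mem_interval ht] at hv
      rw [hy t ht, if_neg hv]
  · rcases B.arrow_cases α with ⟨t, ht, rfl⟩ | ⟨t, ht, rfl⟩
    · rw [B.src_ax t ht] at hα ⊢
      rw [x_mem_interval (by omega)] at hα
      rw [B.tgt_ax t ht, hx t (by omega), hx (t + 1) (by omega), if_pos hα,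
        B.arrow_smul_X hα.1 ht]
      split_ifs with h
      · rfl
      · have hs : w.s = t := by omega
        have hr : w.r = 0 := (w.connected (hα.1.trans hα.2)).resolve_right (by omega)
        have := hz (hst.mpr hr)
        rwa [hr, hz0 hr, ← hs]
    · rw [B.src_ay t ht] at hα ⊢
      rw [y_mem_interval (by omega)] at hα
      rw [B.tgt_ay t ht, hy t (by omega), hy (t + 1) (by omega), if_pos hα,
        B.arrow_smul_Y hα.1 ht]
      split_ifs with h
      · rfl
      · have hs : w.q = t := by omega
        rwa [← hs]
  · rw [hy j (by omega), if_pos ⟨w.p_le, w.le_q⟩]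

theorem exists_isFunctionalFamily (w : Window n m j) {a : M}
    (ha : a ∉ B.lowerRad k M j w.p w.s ⊔ B.upperRad k M j w.q w.r) :
    ∃ φ : V → M →ₗ[k] k, Thin.IsFunctionalFamily (B.interval w) φ ∧ φ (B.y j) a ≠ 0 := by
  have := w.p_le
  have := w.le_q
  have := w.q_le
  have := w.r_le
  have := w.s_le
  have hst := w.start_iff
  have hfi := w.finish_iff
  obtain ⟨φ₀, hφa, hφ⟩ := Submodule.exists_le_ker_of_notMem ha
  have hlow := le_sup_left.trans hφ
  obtain ⟨ψ, hψR, hψ⟩ := exists_functional_comp_eq _ _ (le_sup_right.trans hφ)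
  replace hψ : ∀ z, ψ (B.Y j w.q • z) = φ₀ z := hψ
  have hψX : w.q = m + 1 → 1 ≤ w.r → ∀ z : M, ψ (B.X (w.r - 1) (n + 1) • z) = 0 := by
    intro h1 h2 z
    rw [if_pos ⟨h1, h2⟩] at hψR
    exact hψR ⟨z, rfl⟩
  obtain ⟨χ, hχ1, hχ0⟩ : ∃ χ : M →ₗ[k] k, (w.s = n + 1 → χ = ψ) ∧
      (w.p = 0 → ∀ z, χ (B.X 0 w.s • z) = ψ (B.Y 0 w.q • z)) := by
    by_cases hs : w.s = n + 1
    · refine ⟨ψ, fun _ => rfl, fun _ z => ?_⟩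
      rw [hs, hfi.mpr hs, X_zero_last]
    by_cases hp : w.p = 0
    · obtain ⟨χ, -, hχ⟩ := exists_functional_comp_eq (k := k)
        (Algebra.lsmul k k M (B.X 0 w.s)) ⊥
        (φ := ψ ∘ₗ Algebra.lsmul k k M (B.Y 0 w.q)) (by
          intro z hz
          have hz' : B.X 0 w.s • z = 0 := by simpa using hz
          have : φ₀ (B.Y 0 j • z) = 0 := by
            refine hlow ?_
            rw [hp]
            exact B.mem_lowerRad_zero.mpr ⟨z, hz', rfl⟩
          change ψ (B.Y 0 w.q • z) = 0
          rw [← this, ← hψ, B.Y_smul_Y (by omega) (by omega)])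
      exact ⟨χ, fun h => (hs h).elim, fun _ => hχ⟩
    · exact ⟨0, fun h => (hs h).elim, fun h => (hp h).elim⟩
  obtain ⟨φ, hx, hy⟩ := B.exists_glue
    (fun t => if w.r ≤ t ∧ t ≤ w.s then χ ∘ₗ Algebra.lsmul k k M (B.X t w.s) else 0)
    (fun t => if w.p ≤ t ∧ t ≤ w.q then ψ ∘ₗ Algebra.lsmul k k M (B.Y t w.q) else 0) (by
      by_cases hp : w.p = 0
      · rw [if_pos (by omega), if_pos (by omega)]
        exact LinearMap.ext (hχ0 hp)
      · rw [if_neg (by omega), if_neg (by omega)]) (by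
      by_cases hq : w.q = m + 1
      · rw [if_pos (by omega), if_pos (by omega), hχ1 (hfi.mp hq), hq, hfi.mp hq, X_last_last]
      · rw [if_neg (by omega), if_neg (by omega)])
  refine ⟨φ, ⟨fun v z => ?_, fun v hv => ?_, fun α z hα => ?_⟩, ?_⟩
  · rcases B.vertex_cases v with ⟨t, ht, rfl⟩ | ⟨t, ht, rfl⟩
    · rw [hx t ht]
      split_ifs with h
      · exact congrArg χ (B.X_smul_idem h.2 z)
      · rfl
    · rw [hy t ht]
      split_ifs with h
      · exact congrArg ψ (B.Y_smul_idem h.2 z)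
      · rfl
  · rcases B.vertex_cases v with ⟨t, ht, rfl⟩ | ⟨t, ht, rfl⟩
    · rw [x_mem_interval ht] at hv
      rw [hx t ht, if_neg hv]
    · rw [y_mem_interval ht] at hv
      rw [hy t ht, if_neg hv]
  · rcases B.arrow_cases α with ⟨t, ht, rfl⟩ | ⟨t, ht, rfl⟩
    · rw [B.tgt_ax t ht] at hα ⊢
      rw [x_mem_interval (by omega)] at hα
      rw [B.src_ax t ht, hx t (by omega), hx (t + 1) (by omega), if_pos hα]
      change χ (B.X (t + 1) w.s • P.arrow (B.ax t) • z) = _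
      rw [B.X_smul_arrow hα.2 ht]
      split_ifs with h
      · rfl
      · have hr : w.r = t + 1 := by omega
        have hs : w.s = n + 1 :=
          (w.connected (hα.1.trans hα.2)).resolve_left (by omega)
        have := hψX (hfi.mpr hs) (by omega) z
        rw [hχ1 hs, hs]
        rwa [hr, Nat.add_sub_cancel] at this
    · rw [B.tgt_ay t ht] at hα ⊢
      rw [y_mem_interval (by omega)] at hα
      rw [B.src_ay t ht, hy t (by omega), hy (t + 1) (by omega), if_pos hα]
      change ψ (B.Y (t + 1) w.q • P.arrow (B.ay t) • z) = _
      rw [B.Y_smul_arrow hα.2 ht]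
      split_ifs with h
      · rfl
      · have hp : w.p = t + 1 := by omega
        rw [← B.Y_smul_Y (show t ≤ j by omega) w.le_q, hψ]
        refine hlow ?_
        rw [hp]
        exact B.mem_lowerRad_succ.mpr ⟨z, rfl⟩
  · rw [hy j (by omega), if_pos ⟨w.p_le, w.le_q⟩]
    change ψ (B.Y j w.q • a) ≠ 0
    rwa [hψ]

end TwoBranches

namespace TwoBranches

variable {P : QuiverPresentation k A V E} {n m : ℕ} (B : P.TwoBranches n m)

section Filtration

variable {M : Type} [AddCommGroup M] [Module A M] [Module k M] [IsScalarTower k A M] {j : ℕ}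

variable (k M) in
/-- The filtration of the space at the vertex `y j` by the positions of the windows. -/
noncomputable def filtration (j L : ℕ) : AddSubgroup M :=
  AddSubgroup.closure {a | ∃ w : Window n m j, L ≤ w.level ∧
    a ∈ B.lower k M j w.p w.s ∧ a ∈ B.upper k M j w.q w.r}

theorem mem_filtration (w : Window n m j) {L : ℕ} (hL : L ≤ w.level) {a : M}
    (ha : a ∈ B.lower k M j w.p w.s) (ha' : a ∈ B.upper k M j w.q w.r) :
    a ∈ B.filtration k M j L :=
  AddSubgroup.subset_closure ⟨w, hL, ha, ha'⟩

theorem filtration_eq_bot {L : ℕ} (hL : 2 * n + m + 3 ≤ L) : B.filtration k M j L = ⊥ := by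
  rw [filtration, AddSubgroup.closure_eq_bot_iff]
  rintro a ⟨w, hw, -⟩
  have := w.level_le
  omega

theorem lowerRad_le_lower (w : Window n m j) :
    B.lowerRad k M j w.p w.s ≤ B.lower k M j w.p w.s := by
  have := w.p_le
  have := w.s_le
  intro a ha
  rw [mem_lower]
  rcases hp : w.p with _ | p
  · rw [hp, mem_lowerRad_zero] at ha
    obtain ⟨z, hz, rfl⟩ := ha
    refine ⟨z, rfl, fun _ => ?_⟩
    rw [← B.X_smul_X w.s.zero_le w.s.le_succ, hz, smul_zero]
  · rw [hp, mem_lowerRad_succ] at ha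
    obtain ⟨z, rfl⟩ := ha
    exact ⟨B.Y p (p + 1) • z, B.Y_smul_Y (by omega) (by omega) z, fun h => (by omega)⟩

theorem upperRad_le_upper (w : Window n m j) :
    B.upperRad k M j w.q w.r ≤ B.upper k M j w.q w.r := by
  have := w.le_q
  have := w.q_le
  have := w.r_le
  intro a ha
  rw [mem_upper]
  by_cases h : w.q = m + 1 ∧ 1 ≤ w.r
  · rw [h.1, B.mem_upperRad_of_pos h.2] at ha
    rw [h.1, Y_eq_zero _ (by omega), zero_smul]
    obtain ⟨z, hz⟩ := ha
    exact ⟨rfl, fun _ => ⟨B.X (w.r - 1) w.r • z, by rw [B.X_smul_X (by omega) (by omega), hz]⟩⟩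
  · rw [B.mem_upperRad_of_not h] at ha
    refine ⟨by rw [← B.Y_smul_Y w.le_q w.q.le_succ, ha, smul_zero], fun hq => ⟨0, ?_⟩⟩
    rw [← hq, ha, smul_zero]

theorem mem_filtration_of_kills_last {L : ℕ} (hL : L ≤ j + n + 2) (hj : j ≤ m + 1) {z : M}
    (hz : B.Y 0 (m + 1) • z = 0) : B.Y 0 j • z ∈ B.filtration k M j L := by
  rcases Nat.lt_or_ge m j with h | h
  · obtain rfl : j = m + 1 := by omega
    rw [hz]
    exact zero_mem _
  · refine B.mem_filtration
      { p := 0, q := m, r := 0, s := n, p_le := by omega, le_q := h, q_le := by omega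
        r_le := by omega, s_le := by omega, start_iff := by simp, finish_iff := by simp
        connected := by simp } ?_ ?_ ?_
    · dsimp only [Window.level]
      split_ifs <;> omega
    · exact B.mem_lower.mpr ⟨z, rfl, fun _ => by rw [X_zero_last, hz]⟩
    · exact B.mem_upper.mpr ⟨by rw [B.Y_smul_Y j.zero_le hj, hz], fun h => by simp at h⟩

theorem Y_smul_mem_filtration {L : ℕ} (hL : L ≤ j + n + 1) (hj : j ≤ m + 1) (z : M) :
    B.Y 0 j • z ∈ B.filtration k M j L := by
  refine B.mem_filtration
    { p := 0, q := m + 1, r := 0, s := n + 1, p_le := by omega, le_q := hj, q_le := le_rfl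
      r_le := by omega, s_le := le_rfl, start_iff := by simp, finish_iff := by simp
      connected := by simp } ?_ ?_ ?_
  · dsimp only [Window.level]
    split_ifs <;> omega
  · exact B.mem_lower.mpr ⟨z, rfl, fun _ => by rw [X_eq_zero _ (by omega), zero_smul]⟩
  · refine B.mem_upper.mpr ⟨by rw [Y_eq_zero _ hj, zero_smul], fun _ => ⟨z, ?_⟩⟩
    rw [X_zero_last, B.Y_smul_Y j.zero_le hj]

theorem mem_filtration_of_mem_lowerRad (w : Window n m j) {a : M}
    (ha : a ∈ B.lowerRad k M j w.p w.s) (ha' : a ∈ B.upper k M j w.q w.r) :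
    a ∈ B.filtration k M j (w.level + 1) := by
  obtain ⟨p, q, r, s, h1, h2, h3, h4, h5, h6, h7, h8⟩ := w
  simp only at ha ha'
  rcases p with _ | p
  · obtain rfl : r = 0 := h6.mp rfl
    obtain ⟨z, hz, rfl⟩ := B.mem_lowerRad_zero.mp ha
    by_cases hq : q = m + 1
    · subst hq
      obtain rfl : s = n + 1 := h7.mp rfl
      refine B.mem_filtration_of_kills_last ?_ h2 (by rw [← X_zero_last, hz])
      dsimp only [Window.level]
      split_ifs <;> omega
    rcases s with _ | s
    · rw [X_zero_zero] at hz
      rw [← B.Y_smul_Y le_rfl j.zero_le, hz, smul_zero]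
      exact zero_mem _
    · refine B.mem_filtration ⟨0, q, 0, s, h1, h2, h3, h4, by omega, h6, by omega, by simp⟩
        ?_ ?_ ha'
      · dsimp only [Window.level]
        split_ifs <;> omega
      · exact B.mem_lower.mpr ⟨z, rfl, fun _ => hz⟩
  · obtain ⟨z, rfl⟩ := B.mem_lowerRad_succ.mp ha
    rcases p with _ | p
    · by_cases hq : q = m + 1
      · refine B.Y_smul_mem_filtration ?_ (by omega) z
        dsimp only [Window.level]
        split_ifs <;> omega
      · have hu := B.mem_upper.mp ha'
        refine B.mem_filtration
          ⟨0, q, 0, n, by omega, h2, h3, by omega, by omega, by simp, by simp [hq], by simp⟩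
          ?_ ?_ (B.mem_upper.mpr ⟨hu.1, fun h => (hq h).elim⟩)
        · dsimp only [Window.level]
          split_ifs <;> first | omega | contradiction
        · refine B.mem_lower.mpr ⟨z, rfl, fun _ => ?_⟩
          have h0 := hu.1
          rw [B.Y_smul_Y j.zero_le (by omega)] at h0
          rw [X_zero_last, ← B.Y_smul_Y (q + 1).zero_le (show q + 1 ≤ m + 1 by omega), h0,
            smul_zero]
    · refine B.mem_filtration ⟨p + 1, q, r, s, by omega, h2, h3, h4, h5, by omega, h7, h8⟩
        ?_ (B.mem_lower.mpr ⟨z, rfl, fun h => by dsimp only at h; omega⟩) ha'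
      dsimp only [Window.level]
      split_ifs <;> first | omega | contradiction

theorem mem_filtration_of_mem_upperRad (w : Window n m j) {a : M}
    (ha : a ∈ B.lower k M j w.p w.s) (ha' : a ∈ B.upperRad k M j w.q w.r) :
    a ∈ B.filtration k M j (w.level + 1) := by
  obtain ⟨p, q, r, s, h1, h2, h3, h4, h5, h6, h7, h8⟩ := w
  simp only at ha ha'
  obtain ⟨z, hz, hz0⟩ := B.mem_lower.mp ha
  by_cases hq : q = m + 1 ∧ 1 ≤ r
  · obtain ⟨rfl, hr⟩ := hq
    obtain ⟨z', hz'⟩ := (B.mem_upperRad_of_pos hr).mp ha'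
    obtain rfl : s = n + 1 := h7.mp rfl
    by_cases hr1 : r = 1
    · subst hr1
      replace hz' : B.Y 0 (m + 1) • z' = B.Y j (m + 1) • a := by rw [← X_zero_last, ← hz']
      rw [← add_sub_cancel (B.Y 0 j • z') a]
      refine add_mem (B.Y_smul_mem_filtration ?_ h2 z') ?_
      · dsimp only [Window.level]
        split_ifs <;> omega
      have hd : a - B.Y 0 j • z' = B.Y p j • (z - B.Y 0 p • z') := by
        rw [smul_sub, B.Y_smul_Y p.zero_le h1, hz]
      have hk : B.Y j (m + 1) • (a - B.Y 0 j • z') = 0 := by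
        rw [smul_sub, B.Y_smul_Y j.zero_le h2, hz', sub_self]
      rcases Nat.lt_or_ge m j with h | h
      · obtain rfl : j = m + 1 := by omega
        rw [hd] at hk ⊢
        rw [B.eq_zero_of_Y_self_smul h1 hk]
        exact zero_mem _
      · refine B.mem_filtration
          ⟨p, m, 1, 0, h1, h, by omega, h4, by omega, h6, by omega, by omega⟩ ?_ ?_ ?_
        · dsimp only [Window.level]
          split_ifs <;> omega
        · exact B.mem_lower.mpr ⟨_, hd.symm, fun h => by dsimp only at h; omega⟩
        · exact B.mem_upper.mpr ⟨hk, fun h => by dsimp only at h; omega⟩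
    · refine B.mem_filtration
        ⟨p, m + 1, r - 1, n + 1, h1, h2, h3, by omega, h5, by omega, h7, by simp⟩ ?_ ha ?_
      · dsimp only [Window.level]
        split_ifs <;> omega
      · exact B.mem_upper.mpr ⟨by rw [Y_eq_zero _ h2, zero_smul], fun _ => ⟨z', hz'⟩⟩
  · have hk := (B.mem_upperRad_of_not hq).mp ha'
    by_cases hqm : q = m + 1
    · obtain rfl : r = 0 := by omega
      obtain rfl : p = 0 := h6.mpr rfl
      obtain rfl : s = n + 1 := h7.mp hqm
      subst hqm
      rw [← hz, B.Y_smul_Y j.zero_le h2] at hk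
      rw [← hz]
      refine B.mem_filtration_of_kills_last ?_ h2 hk
      dsimp only [Window.level]
      split_ifs <;> omega
    · by_cases hqj : q = j
      · subst hqj
        rw [← hz] at hk ⊢
        rw [B.eq_zero_of_Y_self_smul h1 hk]
        exact zero_mem _
      · refine B.mem_filtration
          ⟨p, q - 1, r, s, h1, by omega, by omega, h4, h5, h6, by omega, h8⟩ ?_ ha ?_
        · dsimp only [Window.level]
          split_ifs <;> omega
        · refine B.mem_upper.mpr ⟨?_, fun h => by dsimp only at h; omega⟩
          rwa [Nat.sub_add_cancel (by omega)]

theorem idem_smul_mem_filtration (hj : j ≤ m + 1) (z : M) :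
    P.idem (B.y j) • z ∈ B.filtration k M j 1 := by
  have hY : P.idem (B.y j) • z = B.Y j j • z := by rw [Y, branchPath_self]
  rw [hY]
  rcases Nat.eq_zero_or_pos j with rfl | h
  · exact B.Y_smul_mem_filtration (by omega) hj z
  · refine B.mem_filtration
      ⟨j, m + 1, n + 1, n + 1, le_rfl, hj, le_rfl, le_rfl, le_rfl, by omega, by simp, by simp⟩
      ?_ ?_ ?_
    · dsimp only [Window.level]
      split_ifs <;> omega
    · exact B.mem_lower.mpr ⟨z, rfl, fun h => by dsimp only at h; omega⟩
    · refine B.mem_upper.mpr ⟨by rw [Y_eq_zero _ hj, zero_smul],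
        fun _ => ⟨B.Y j (m + 1) • z, ?_⟩⟩
      rw [X_last_last, B.Y_smul_Y hj le_rfl, B.Y_smul_Y le_rfl hj]

end Filtration

open scoped ModuleCat

theorem map_mem_filtration {j : ℕ} {X Y : ModuleCat.{0} A} {f : X ⟶ Y} (hf : f ∈ radSet A X Y)
    {L : ℕ} {a : X} (ha : a ∈ B.filtration k X j L) :
    f.hom a ∈ B.filtration k Y j (L + 1) := by
  obtain ⟨R⟩ := B.nonempty_thin
  induction ha using AddSubgroup.closure_induction with
  | zero => rw [map_zero]; exact zero_mem _
  | add a b _ _ iha ihb => rw [map_add]; exact add_mem iha ihb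
  | neg a _ iha => rw [map_neg]; exact neg_mem iha
  | mem a h =>
    obtain ⟨w, hL, hlow, hup⟩ := h
    have hlow' : f.hom a ∈ B.lower k Y j w.p w.s := by
      obtain ⟨z, rfl, hz⟩ := B.mem_lower.mp hlow
      exact B.mem_lower.mpr ⟨f.hom z, (map_smul _ _ _).symm, fun h => by
        rw [← map_smul, hz h, map_zero]⟩
    have hup' : f.hom a ∈ B.upper k Y j w.q w.r := by
      obtain ⟨h0, h1⟩ := B.mem_upper.mp hup
      refine B.mem_upper.mpr ⟨by rw [← map_smul, h0, map_zero], fun h => ?_⟩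
      obtain ⟨z, hz⟩ := h1 h
      exact ⟨f.hom z, by rw [← map_smul, ← map_smul, hz]⟩
    have hrad : f.hom a ∈ B.lowerRad k Y j w.p w.s ⊔ B.upperRad k Y j w.q w.r := by
      by_contra hnot
      obtain ⟨φ, hφ, hne⟩ := B.exists_isFunctionalFamily w hnot
      obtain ⟨g, hg, rfl⟩ := B.exists_isVecFamily k w hlow hup
      exact hne (Thin.radSet_functional_eq_zero R (isConnected_interval w) (base_mem_interval w)
        hf hg hφ)
    obtain ⟨b, hb, c, hc, hbc⟩ := Submodule.mem_sup.mp hrad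
    have hb' : b ∈ B.upper k Y j w.q w.r := by
      rw [eq_sub_of_add_eq hbc]
      exact sub_mem hup' (B.upperRad_le_upper w hc)
    have hc' : c ∈ B.lower k Y j w.p w.s := by
      rw [eq_sub_of_add_eq' hbc]
      exact sub_mem hlow' (B.lowerRad_le_lower w hb)
    have hmono : B.filtration k Y j (w.level + 1) ≤ B.filtration k Y j (L + 1) :=
      AddSubgroup.closure_mono fun x ⟨w', h, h'⟩ => ⟨w', by omega, h'⟩
    rw [← hbc]
    exact hmono (add_mem (B.mem_filtration_of_mem_lowerRad w hb hb')
      (B.mem_filtration_of_mem_upperRad w hc' hc))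

theorem map_mem_filtration_of_radPowSet {j N : ℕ} {X Y : ModuleCat.{0} A} {f : X ⟶ Y}
    (hf : f ∈ radPowSet A (N + 1) X Y) {L : ℕ} {a : X} (ha : a ∈ B.filtration k X j L) :
    ∃ (Z : ModuleCat.{0} A) (g : Z ⟶ Y), ∃ b ∈ B.filtration k Z j (L + N + 1),
      f.hom a = g.hom b := by
  induction N generalizing X L with
  | zero =>
    obtain ⟨Z, g, h, -, hg, -, rfl⟩ := hf
    exact ⟨Z, h, g.hom a, B.map_mem_filtration hg ha, rfl⟩
  | succ N ih =>
    obtain ⟨Z, g, h, -, hg, hh, rfl⟩ := hf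
    obtain ⟨Z', g', b, hb, h'⟩ := ih hh (B.map_mem_filtration hg ha)
    exact ⟨Z', g', b, by rwa [show L + (N + 1) + 1 = L + 1 + N + 1 by omega], h'⟩

theorem idem_smul_mem_ker {j N : ℕ} (hj : j ≤ m + 1) (hN : 2 * n + m + 2 ≤ N)
    {X Y : ModuleCat.{0} A} {f : X ⟶ Y} (hf : f ∈ radPowSet A N X Y) (z : X) :
    f.hom (P.idem (B.y j) • z) = 0 := by
  obtain ⟨N, rfl⟩ : ∃ N', N = N' + 1 := ⟨N - 1, by omega⟩
  obtain ⟨Z, g, b, hb, h⟩ :=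
    B.map_mem_filtration_of_radPowSet hf (B.idem_smul_mem_filtration (k := k) hj z)
  rw [B.filtration_eq_bot (by omega), AddSubgroup.mem_bot] at hb
  rw [h, hb, map_zero]

theorem radVanishes (B : P.TwoBranches n m) {N : ℕ} (h1 : 2 * n + m + 2 ≤ N)
    (h2 : 2 * m + n + 2 ≤ N) : RadVanishes A N := by
  intro X Y _ _ f hf
  ext z
  change f.hom z = 0
  rw [← one_smul A z, ← P.sum_idem, Finset.sum_smul, map_sum]
  refine Finset.sum_eq_zero fun v _ => ?_
  rcases B.vertex_cases v with ⟨t, ht, rfl⟩ | ⟨t, ht, rfl⟩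
  · exact B.swap.idem_smul_mem_ker ht h2 hf z
  · exact B.idem_smul_mem_ker ht h1 hf z

end TwoBranches

theorem wprod_ofFn_eq_branchPath {P : QuiverPresentation k A V E} {x : ℕ → V} {ax : ℕ → E} {n : ℕ}
    (hsrc : ∀ t ≤ n, P.src (ax t) = x t) {d : ℕ} (hd : d ≤ n) :
    P.wprod (List.ofFn fun i : Fin (d + 1) => ax i) = P.branchPath x ax n 0 (d + 1) := by
  induction d with
  | zero =>
    rw [branchPath_succ le_rfl hd, branchPath_self, ← hsrc 0 hd, P.arrow_mul_idem]
    simp [wprod]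
  | succ d ih =>
    rw [branchPath_succ (Nat.zero_le _) hd, ← ih (by omega), List.ofFn_succ_last]
    simp [wprod]

/-- The two branches of a toupie quiver. -/
theorem exists_twoBranches (P : QuiverPresentation k A V E) (n1 n2 : ℕ)
    (v : Fin (n1 + n2 + 2) ≃ V) (ar : Fin (n1 + n2 + 2) ≃ E)
    (hends : ∀ i : Fin (n1 + n2 + 2), ∃ a b : Fin (n1 + n2 + 2),
      (a : ℕ) = (toupie2Ends n1 n2 i).1 ∧ (b : ℕ) = (toupie2Ends n1 n2 i).2 ∧
      P.src (ar i) = v a ∧ P.tgt (ar i) = v b)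
    (arr : ℕ → E) (harr : ∀ i (h : i < n1 + n2 + 2), arr i = ar ⟨i, h⟩)
    (hcomm : P.wprod (List.ofFn fun j : Fin (n1 + 1) => arr j) =
      P.wprod (List.ofFn fun j : Fin (n2 + 1) => arr (n1 + 1 + j)))
    (hcne : P.wprod (List.ofFn fun j : Fin (n1 + 1) => arr j) ≠ 0) :
    Nonempty (P.TwoBranches n2 n1) := by
  let ver : ℕ → V := fun i => if h : i < n1 + n2 + 2 then v ⟨i, h⟩ else v 0
  have hver : ∀ i (h : i < n1 + n2 + 2), ver i = v ⟨i, h⟩ := fun i h => dif_pos h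
  have hinj : ∀ i i', i < n1 + n2 + 2 → i' < n1 + n2 + 2 → ver i = ver i' → i = i' := by
    intro i i' h h' heq
    rw [hver i h, hver i' h'] at heq
    exact congrArg Fin.val (v.injective heq)
  have hst : ∀ i, i < n1 + n2 + 2 → P.src (arr i) = ver (toupie2Ends n1 n2 (Fin.ofNat _ i)).1 ∧
      P.tgt (arr i) = ver (toupie2Ends n1 n2 (Fin.ofNat _ i)).2 := by
    intro i h
    have hi : Fin.ofNat (n1 + n2 + 2) i = ⟨i, h⟩ := Fin.ext (Nat.mod_eq_of_lt h)
    obtain ⟨a, b, ha, hb, hs, ht⟩ := hends ⟨i, h⟩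
    rw [hi, ← ha, ← hb, harr i h, hs, ht, hver a a.isLt, hver b b.isLt]
    exact ⟨rfl, rfl⟩
  let y : ℕ → V := fun t => ver (if t ≤ n1 then t else n1 + n2 + 1)
  let x : ℕ → V := fun t => ver (if t = 0 then 0 else n1 + t)
  have hval : ∀ i, i < n1 + n2 + 2 → (Fin.ofNat (n1 + n2 + 2) i : ℕ) = i :=
    fun i h => Nat.mod_eq_of_lt h
  have src_ay : ∀ t ≤ n1, P.src (arr t) = y t := by
    intro t ht
    rw [(hst t (by omega)).1]
    refine congrArg ver ?_
    simp only [toupie2Ends, hval t (by omega)]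
    split_ifs <;> dsimp only <;> omega
  have tgt_ay : ∀ t ≤ n1, P.tgt (arr t) = y (t + 1) := by
    intro t ht
    rw [(hst t (by omega)).2]
    refine congrArg ver ?_
    simp only [toupie2Ends, hval t (by omega)]
    split_ifs <;> dsimp only <;> omega
  have src_ax : ∀ t ≤ n2, P.src (arr (n1 + 1 + t)) = x t := by
    intro t ht
    rw [(hst _ (by omega)).1]
    refine congrArg ver ?_
    simp only [toupie2Ends, hval (n1 + 1 + t) (by omega)]
    split_ifs <;> dsimp only <;> omega
  have tgt_ax : ∀ t ≤ n2, P.tgt (arr (n1 + 1 + t)) = x (t + 1) := by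
    intro t ht
    rw [(hst _ (by omega)).2]
    refine congrArg ver ?_
    simp only [toupie2Ends, hval (n1 + 1 + t) (by omega)]
    split_ifs <;> first | omega | contradiction
  rw [wprod_ofFn_eq_branchPath src_ay le_rfl] at hcomm hcne
  rw [wprod_ofFn_eq_branchPath (ax := fun t => arr (n1 + 1 + t)) src_ax le_rfl] at hcomm
  refine ⟨{
    x := x
    y := y
    ax := fun t => arr (n1 + 1 + t)
    ay := arr
    start := by simp [x, y]
    finish := congrArg ver (by simp; omega)
    x_inj := fun s t hs ht h => ?_
    y_inj := fun s t hs ht h => ?_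
    x_eq_y := fun s t hs ht h => ?_
    vertex_cases := fun u => ?_
    arrow_cases := fun α => ?_
    src_ax := src_ax
    tgt_ax := tgt_ax
    src_ay := src_ay
    tgt_ay := tgt_ay
    comm := hcomm.symm
    ne_zero := hcomm ▸ hcne }⟩
  · have := hinj _ _ (by split_ifs <;> omega) (by split_ifs <;> omega) h
    split_ifs at this <;> omega
  · have := hinj _ _ (by split_ifs <;> omega) (by split_ifs <;> omega) h
    split_ifs at this <;> omega
  · have := hinj _ _ (by split_ifs <;> omega) (by split_ifs <;> omega) h
    split_ifs at this <;> omega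
  · obtain ⟨i, rfl⟩ := v.surjective u
    rw [← hver i i.isLt]
    by_cases h : (i : ℕ) ≤ n1
    · exact Or.inr ⟨i, by omega, congrArg ver (if_pos h)⟩
    · refine Or.inl ⟨i - n1, by omega, congrArg ver ?_⟩
      split_ifs <;> omega
  · obtain ⟨i, rfl⟩ := ar.surjective α
    rw [← harr i i.isLt]
    by_cases h : (i : ℕ) ≤ n1
    · exact Or.inr ⟨i, h, rfl⟩
    · exact Or.inl ⟨i - (n1 + 1), by omega, congrArg arr (by omega)⟩

end QuiverPresentation
/-- Theorem: for a representation-finite toupie algebra with two branches of lengths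
`n1 ≤ n2` and the single commutative relation, the nilpotency index of the radical of
`mod A` equals `n1 + 2 n2 + 2`. -/
theorem nilpotency_index_toupie_two_branches (k A : Type) [Field k] [IsAlgClosed k] [Ring A] [Algebra k A]
    [FiniteDimensional k A] (V E : Type) [Fintype V] [Fintype E]
    (P : QuiverPresentation k A V E) (hadm : P.Admissible) (hmin : P.Minimal)
    (n1 n2 : ℕ) (h1 : 1 ≤ n1) (h12 : n1 ≤ n2)
    (v : Fin (n1 + n2 + 2) ≃ V) (ar : Fin (n1 + n2 + 2) ≃ E)
    (hends : ∀ i : Fin (n1 + n2 + 2), ∃ a b : Fin (n1 + n2 + 2),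
      (a : ℕ) = (toupie2Ends n1 n2 i).1 ∧ (b : ℕ) = (toupie2Ends n1 n2 i).2 ∧
      P.src (ar i) = v a ∧ P.tgt (ar i) = v b)
    (hcomm : P.wprod (List.ofFn fun j : Fin (n1 + 1) =>
        ar ⟨(j : ℕ), by have := j.isLt; omega⟩) =
      P.wprod (List.ofFn fun j : Fin (n2 + 1) =>
        ar ⟨n1 + 1 + (j : ℕ), by have := j.isLt; omega⟩))
    (hcne : P.wprod (List.ofFn fun j : Fin (n1 + 1) =>
        ar ⟨(j : ℕ), by have := j.isLt; omega⟩) ≠ 0)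
    (hdim : Module.finrank k A =
      (n1 + 2) * (n1 + 3) / 2 + (n2 + 2) * (n2 + 3) / 2 - 3)
    (hrf : RepFinite A) :
    NilpotencyIndex A (n1 + 2 * n2 + 2) := by
  let arr : ℕ → E := fun i => if h : i < n1 + n2 + 2 then ar ⟨i, h⟩ else ar 0
  have harr : ∀ i (h : i < n1 + n2 + 2), arr i = ar ⟨i, h⟩ := fun i h => dif_pos h
  simp only [← harr] at hcomm hcne
  obtain ⟨B⟩ := P.exists_twoBranches n1 n2 v ar hends arr harr hcomm hcne
  refine ⟨by omega, B.radVanishes (by omega) (by omega), fun l hl => ?_⟩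
  by_contra hlt
  exact B.not_radVanishes h1 (RadVanishes.mono A (by omega) hl)
end
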